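/- arXiv:1311.1342 — 6 statements merged into one kernel-verified Lean document; each statement's English description precedes it below -/
import Mathlib

section
/- If f ∈ D([0,T];V), i.e. f : [0,T] → V is càdlàg, then the oscillation function vanishes in the limit: M(f; δ) → 0 as δ ↘ 0. -/
noncomputable section

open Filter Set Topology

/-- Distance from `v` to the segment joining `v₁` and `v₂`:
`M(v₁, v, v₂) = inf_{α ∈ [0,1]} ‖v − (α v₁ + (1 − α) v₂)‖`. -/
def segDist {V : Type*} [NormedAddCommGroup V] [NormedSpace ℝ V]
    (v₁ v v₂ : V) : ℝ :=
  sInf {d : ℝ | ∃ α ∈ Set.Icc (0:ℝ) 1, d = ‖v - (α • v₁ + (1 - α) • v₂)‖}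

/-- Left limit `f(t−)` of `f` at `t` for the interval starting at `a`, with `f(a−) := f(a)`. -/
def leftLimIn {V : Type*} [NormedAddCommGroup V] (f : ℝ → V) (a t : ℝ) : V :=
  if a < t then Function.leftLim f t else f a

/-- `f` is càdlàg on `[a,b]`: right-continuous at every `t ∈ [a,b)` and
having a left limit at every `t ∈ (a,b]`. -/
def IsCadlagOn {V : Type*} [NormedAddCommGroup V] (f : ℝ → V) (a b : ℝ) : Prop :=
  (∀ t ∈ Set.Ico a b, Filter.Tendsto f (nhdsWithin t (Set.Ioc t b)) (nhds (f t))) ∧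
  (∀ t ∈ Set.Ioc a b, ∃ l, Filter.Tendsto f (nhdsWithin t (Set.Ico a t)) (nhds l))

/-- The extended graph `Γ(f)` of `f` on `[a,b]`. -/
def extGraph {V : Type*} [NormedAddCommGroup V] [NormedSpace ℝ V]
    (f : ℝ → V) (a b : ℝ) : Set (ℝ × V) :=
  {p | p.1 ∈ Set.Icc a b ∧ ∃ α ∈ Set.Icc (0:ℝ) 1,
      p.2 = α • leftLimIn f a p.1 + (1 - α) • f p.1}

/-- The total order on the extended graph of `f`. -/
def graphLE {V : Type*} [NormedAddCommGroup V] (f : ℝ → V) (a : ℝ) (p q : ℝ × V) : Prop :=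
  p.1 < q.1 ∨ (p.1 = q.1 ∧ ‖leftLimIn f a p.1 - p.2‖ ≤ ‖leftLimIn f a p.1 - q.2‖)

/-- `(r, u)` is a parametric representation of the extended graph of `f` on `[a,b]`:
a continuous nondecreasing surjection of `[0,1]` onto `Γ(f)` with the correct endpoints. -/
structure IsParamRep {V : Type*} [NormedAddCommGroup V] [NormedSpace ℝ V]
    (f : ℝ → V) (a b : ℝ) (r : ℝ → ℝ) (u : ℝ → V) : Prop where
  contOn : ContinuousOn (fun s => (r s, u s)) (Set.Icc 0 1)
  mem : ∀ s ∈ Set.Icc (0:ℝ) 1, (r s, u s) ∈ extGraph f a b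
  surj : ∀ p ∈ extGraph f a b, ∃ s ∈ Set.Icc (0:ℝ) 1, (r s, u s) = p
  mono : ∀ s₁ ∈ Set.Icc (0:ℝ) 1, ∀ s₂ ∈ Set.Icc (0:ℝ) 1,
      s₁ ≤ s₂ → graphLE f a (r s₁, u s₁) (r s₂, u s₂)
  init : r 0 = a ∧ u 0 = f a
  last : r 1 = b ∧ u 1 = f b

/-- The strong `M₁` Skorokhod metric on `D([a,b];V)`. -/
def dM {V : Type*} [NormedAddCommGroup V] [NormedSpace ℝ V]
    (a b : ℝ) (f₁ f₂ : ℝ → V) : ℝ :=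
  sInf {d : ℝ | ∃ r₁ u₁ r₂ u₂, IsParamRep f₁ a b r₁ u₁ ∧ IsParamRep f₂ a b r₂ u₂ ∧
    d = max (⨆ s : Set.Icc (0:ℝ) 1, |r₁ s.1 - r₂ s.1|)
            (⨆ s : Set.Icc (0:ℝ) 1, ‖u₁ s.1 - u₂ s.1‖)}

/-- The oscillation function `M(f; δ)` on `[a,b]`. -/
def oscM {V : Type*} [NormedAddCommGroup V] [NormedSpace ℝ V]
    (f : ℝ → V) (a b δ : ℝ) : ℝ :=
  sSup {d : ℝ | ∃ t₁ t t₂ : ℝ, a ≤ t₁ ∧ t₁ < t ∧ t < t₂ ∧ t₂ ≤ b ∧ t₂ - t₁ ≤ δ ∧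
    d = segDist (f t₁) (f t) (f t₂)}

end

section

open Filter Set Topology

variable {V : Type*} [NormedAddCommGroup V] [NormedSpace ℝ V]

theorem segDist_nonneg (v₁ v v₂ : V) : 0 ≤ segDist v₁ v v₂ :=
  Real.sInf_nonneg (by rintro _ ⟨α, -, rfl⟩; exact norm_nonneg _)

theorem segDist_le_norm (v₁ v v₂ : V) {α : ℝ} (hα : α ∈ Icc (0 : ℝ) 1) :
    segDist v₁ v v₂ ≤ ‖v - (α • v₁ + (1 - α) • v₂)‖ :=
  csInf_le ⟨0, by rintro _ ⟨β, -, rfl⟩; exact norm_nonneg _⟩ ⟨α, hα, rfl⟩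

theorem segDist_le_dist_left (v₁ v v₂ : V) : segDist v₁ v v₂ ≤ dist v v₁ := by
  simpa [dist_eq_norm] using segDist_le_norm v₁ v v₂ (right_mem_Icc.2 zero_le_one)

theorem segDist_le_dist_right (v₁ v v₂ : V) : segDist v₁ v v₂ ≤ dist v v₂ := by
  simpa [dist_eq_norm] using segDist_le_norm v₁ v v₂ (left_mem_Icc.2 zero_le_one)

theorem oscM_nonneg (f : ℝ → V) (a b δ : ℝ) : 0 ≤ oscM f a b δ :=
  Real.sSup_nonneg (by rintro _ ⟨t₁, t, t₂, -, -, -, -, -, rfl⟩; exact segDist_nonneg _ _ _)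

/-- Near any point of `[a,b]`, the middle value of a càdlàg function on three ordered times is
close to one of the two outer values. -/
theorem IsCadlagOn.exists_segDist_lt {f : ℝ → V} {a b : ℝ} (hf : IsCadlagOn f a b)
    {x : ℝ} (hx : x ∈ Icc a b) {ε : ℝ} (hε : 0 < ε) :
    ∃ η > 0, ∀ t₁ ∈ Metric.ball x η, ∀ t ∈ Metric.ball x η, ∀ t₂ ∈ Metric.ball x η,
      a ≤ t₁ → t₁ < t → t < t₂ → t₂ ≤ b → segDist (f t₁) (f t) (f t₂) < ε := by
  obtain ⟨l, hl⟩ : ∃ l, Tendsto f (𝓝[Ico a x] x) (𝓝 l) := by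
    rcases hx.1.eq_or_lt with rfl | h
    · exact ⟨0, by simp⟩
    · exact hf.2 x ⟨h, hx.2⟩
  have hr : Tendsto f (𝓝[Ioc x b] x) (𝓝 (f x)) := by
    rcases hx.2.eq_or_lt with rfl | h
    · simp
    · exact hf.1 x ⟨hx.1, h⟩
  obtain ⟨η₁, hη₁, h₁⟩ := Metric.tendsto_nhdsWithin_nhds.1 hl (ε / 2) (half_pos hε)
  obtain ⟨η₂, hη₂, h₂⟩ := Metric.tendsto_nhdsWithin_nhds.1 hr (ε / 2) (half_pos hε)
  refine ⟨min η₁ η₂, lt_min hη₁ hη₂, fun t₁ m₁ t m t₂ m₂ ha ht₁ ht₂ hb => ?_⟩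
  simp only [Metric.mem_ball, lt_min_iff] at m₁ m m₂
  rcases lt_or_ge t x with htx | hxt
  · refine (segDist_le_dist_left _ _ _).trans_lt ?_
    have d₁ := h₁ ⟨ha, ht₁.trans htx⟩ m₁.1
    have d := h₁ ⟨ha.trans ht₁.le, htx⟩ m.1
    linarith [dist_triangle_right (f t) (f t₁) l]
  · refine (segDist_le_dist_right _ _ _).trans_lt ?_
    have d₂ := h₂ ⟨hxt.trans_lt ht₂, hb⟩ m₂.2
    have d : dist (f t) (f x) < ε / 2 := by
      rcases hxt.eq_or_lt with rfl | h
      · simpa using half_pos hε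
      · exact h₂ ⟨h, ht₂.le.trans hb⟩ m.2
    linarith [dist_triangle_right (f t) (f t₂) (f x)]

/-- The oscillation function of a càdlàg function is small for all small scales. -/
theorem IsCadlagOn.exists_oscM_le {f : ℝ → V} {a b : ℝ} (hf : IsCadlagOn f a b)
    {ε : ℝ} (hε : 0 < ε) : ∃ δ₀ > 0, ∀ δ < δ₀, oscM f a b δ ≤ ε := by
  choose! η hη h using fun x (hx : x ∈ Icc a b) => hf.exists_segDist_lt hx hε
  obtain ⟨δ₀, hδ₀, hball⟩ := lebesgue_number_lemma_of_metric (isCompact_Icc (a := a) (b := b))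
    (c := fun x : Icc a b => Metric.ball (x : ℝ) (η x)) (fun _ => Metric.isOpen_ball)
    (fun x hx => mem_iUnion.2 ⟨⟨x, hx⟩, Metric.mem_ball_self (hη x hx)⟩)
  refine ⟨δ₀, hδ₀, fun δ hδ => Real.sSup_le ?_ hε.le⟩
  rintro _ ⟨t₁, t, t₂, ha, ht₁, ht₂, hb, hlen, rfl⟩
  obtain ⟨⟨x, hx⟩, hsub⟩ := hball t ⟨ha.trans ht₁.le, ht₂.le.trans hb⟩
  refine (h x hx t₁ (hsub ?_) t (hsub (Metric.mem_ball_self hδ₀)) t₂ (hsub ?_)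
    ha ht₁ ht₂ hb).le <;>
  · rw [Metric.mem_ball, Real.dist_eq, abs_lt]
    constructor <;> linarith

end

/-- if `f ∈ D([0,T];V)` then `M(f; δ) → 0` as `δ ↘ 0`. -/
theorem oscM_tendsto_zero {V : Type*} [NormedAddCommGroup V] [NormedSpace ℝ V]
    (T : ℝ) (hT : 0 < T) (f : ℝ → V) (hf : IsCadlagOn f 0 T) :
    Filter.Tendsto (fun δ => oscM f 0 T δ) (nhdsWithin 0 (Set.Ioi 0)) (nhds 0) := by
  refine Metric.tendsto_nhds.2 fun ε hε => ?_
  obtain ⟨δ₀, hδ₀, h⟩ := hf.exists_oscM_le (half_pos hε)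
  filter_upwards [mem_nhdsWithin_of_mem_nhds (Iio_mem_nhds hδ₀)] with δ hδ
  rw [Real.dist_0_eq_abs, abs_of_nonneg (oscM_nonneg f 0 T δ)]
  exact (h δ hδ).trans_lt (half_lt_self hε)
end

section
/- Let V be a separable real Banach space and T > 0. The function d_M is a metric on D([0,T];V): it is nonnegative and finite, symmetric, satisfies the triangle inequality, and d_M(f₁, f₂) = 0 if and only if f₁ = f₂. -/
section

open Filter Set Topology

/-- A strictly increasing time change with prescribed jump set `J`, given by its left-continuous
version `φm` and its right-continuous version `φ`, normalised to map `[0, T]` onto `[0, 1]`. -/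
structure JumpClock (J : Set ℝ) (T : ℝ) (φm φ : ℝ → ℝ) : Prop where
  le : ∀ t, φm t ≤ φ t
  lt : ∀ t ∈ J, φm t < φ t
  eq : ∀ t, t ∉ J → φm t = φ t
  strict : ∀ t t', t < t' → φ t < φm t'
  left : ∀ t, Tendsto φ (𝓝[<] t) (𝓝 (φm t))
  right : ∀ t, Tendsto φm (𝓝[>] t) (𝓝 (φ t))
  zero : φm 0 = 0
  one : φ T = 1

theorem exists_jumpClock {J : Set ℝ} (hJ : J.Countable) {T : ℝ} (hT : 0 < T) :
    ∃ φm φ : ℝ → ℝ, JumpClock J T φm φ := by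
  classical
  have := hJ.to_subtype
  have := Encodable.ofCountable J
  obtain ⟨w, hw0, c, hwc, -⟩ := posSumOfEncodable one_pos J
  have hws : Summable w := hwc.summable
  have hsum (p : J → Prop) [DecidablePred p] : Summable fun j => if p j then w j else 0 := by
    refine hws.of_nonneg_of_le (fun j => ?_) (fun j => ?_) <;> split_ifs <;>
      simp [(hw0 j).le]
  set A : ℝ → ℝ := fun t => t + ∑' j : J, if (j : ℝ) < t then w j else 0 with hA
  set B : ℝ → ℝ := fun t => t + ∑' j : J, if (j : ℝ) ≤ t then w j else 0 with hB
  have hbound (p : J → Prop) [DecidablePred p] (j : J) : ‖if p j then w j else 0‖ ≤ w j := by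
    split_ifs
    · rw [Real.norm_of_nonneg (hw0 j).le]
    · simpa using (hw0 j).le
  have hle : ∀ t, A t ≤ B t := fun t => by
    refine add_le_add_right ((hsum _).tsum_le_tsum (fun j => ?_) (hsum _)) t
    have := (hw0 j).le
    grind
  have hlt : ∀ t ∈ J, A t < B t := fun t ht => by
    refine add_lt_add_right ((hsum _).tsum_lt_tsum (i := ⟨t, ht⟩) (fun j => ?_) ?_ (hsum _)) t
    · have := (hw0 j).le
      grind
    · simpa using hw0 ⟨t, ht⟩
  have heq : ∀ t, t ∉ J → A t = B t := fun t ht => by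
    simp only [hA, hB]
    congr 2
    ext j
    have : (j : ℝ) ≠ t := fun h => ht (h ▸ j.2)
    simp only [lt_iff_le_and_ne, this, ne_eq, not_false_eq_true, and_true]
  have hstrict : ∀ t t', t < t' → B t < A t' := fun t t' h => by
    refine add_lt_add_of_lt_of_le h ((hsum _).tsum_le_tsum (fun j => ?_) (hsum _))
    have := (hw0 j).le
    grind
  have hleft : ∀ t, Tendsto B (𝓝[<] t) (𝓝 (A t)) := fun t => by
    refine (tendsto_id.mono_left nhdsWithin_le_nhds).add
      (tendsto_tsum_of_dominated_convergence hws (fun j => ?_)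
        (Eventually.of_forall fun s j => hbound (fun j => (j : ℝ) ≤ s) j))
    refine tendsto_const_nhds.congr' ?_
    rcases lt_or_ge (j : ℝ) t with h | h
    · filter_upwards [Ioo_mem_nhdsLT h] with s hs
      simp [h, hs.1.le]
    · filter_upwards [self_mem_nhdsWithin] with s hs
      simp [h.not_gt, (lt_of_lt_of_le hs h).not_ge]
  have hright : ∀ t, Tendsto A (𝓝[>] t) (𝓝 (B t)) := fun t => by
    refine (tendsto_id.mono_left nhdsWithin_le_nhds).add
      (tendsto_tsum_of_dominated_convergence hws (fun j => ?_)
        (Eventually.of_forall fun s j => hbound (fun j => (j : ℝ) < s) j))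
    refine tendsto_const_nhds.congr' ?_
    rcases le_or_gt (j : ℝ) t with h | h
    · filter_upwards [self_mem_nhdsWithin] with s hs
      simp [h, lt_of_le_of_lt h hs]
    · filter_upwards [Ioo_mem_nhdsGT h] with s hs
      simp [h.not_ge, hs.2.not_gt]
  have hD : 0 < B T - A 0 := by linarith [hle 0, hle T, hstrict 0 T hT]
  refine ⟨fun t => (A t - A 0) / (B T - A 0), fun t => (B t - A 0) / (B T - A 0),
    ⟨fun t => ?_, fun t ht => ?_, fun t ht => ?_, fun t t' h => ?_, fun t => ?_, fun t => ?_,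
      ?_, ?_⟩⟩
  · have := hle t
    gcongr
  · have := hlt t ht
    gcongr
  · simp only [heq t ht]
  · have := hstrict t t' h
    gcongr
  · exact ((hleft t).sub_const _).div_const _
  · exact ((hright t).sub_const _).div_const _
  · simp
  · exact div_self hD.ne'

namespace JumpClock

variable {J : Set ℝ} {T : ℝ} {φm φ : ℝ → ℝ}

theorem le_of_mem (h : JumpClock J T φm φ) {t t' s s' : ℝ} (hs : s ∈ Icc (φm t) (φ t))
    (hs' : s' ∈ Icc (φm t') (φ t')) (hss : s ≤ s') : t ≤ t' := by
  by_contra! hlt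
  have := h.strict _ _ hlt
  linarith [hs.1, hs'.2]

theorem Icc_subset (h : JumpClock J T φm φ) {t : ℝ} (ht : t ∈ Icc 0 T) :
    Icc (φm t) (φ t) ⊆ Icc 0 1 := by
  refine Icc_subset_Icc ?_ ?_
  · rcases ht.1.eq_or_lt with rfl | h0
    · exact h.zero.ge
    · linarith [h.strict _ _ h0, h.le 0, h.zero]
  · rcases ht.2.eq_or_lt with rfl | h0
    · exact h.one.le
    · linarith [h.strict _ _ h0, h.le T, h.one]

theorem exists_mem (h : JumpClock J T φm φ) (hT : 0 < T) {s : ℝ} (hs : s ∈ Icc (0 : ℝ) 1) :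
    ∃ t ∈ Icc 0 T, s ∈ Icc (φm t) (φ t) := by
  set S : Set ℝ := {t | t ∈ Icc 0 T ∧ φm t ≤ s}
  have hS0 : (0 : ℝ) ∈ S := ⟨⟨le_rfl, hT.le⟩, h.zero.trans_le hs.1⟩
  have hSb : BddAbove S := ⟨T, fun t ht => ht.1.2⟩
  set t := sSup S
  have ht0 : 0 ≤ t := le_csSup hSb hS0
  have htT : t ≤ T := csSup_le ⟨0, hS0⟩ fun t ht => ht.1.2
  refine ⟨t, ⟨ht0, htT⟩, ?_, ?_⟩
  · refine le_of_tendsto (h.left t) ?_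
    filter_upwards [self_mem_nhdsWithin] with x hx
    obtain ⟨y, hy, hxy⟩ := exists_lt_of_lt_csSup ⟨0, hS0⟩ hx
    exact (h.strict _ _ hxy).le.trans hy.2
  · rcases htT.eq_or_lt with h1 | h1
    · rw [h1, h.one]
      exact hs.2
    · refine ge_of_tendsto (h.right t) ?_
      filter_upwards [Ioo_mem_nhdsGT h1] with x hx
      by_contra! hlt
      exact (le_csSup hSb (show x ∈ S from ⟨⟨ht0.trans hx.1.le, hx.2.le⟩, hlt.le⟩)).not_gt hx.1

end JumpClock

end

section

open Filter Set Topology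

variable {V : Type*} [NormedAddCommGroup V]

theorem leftLimIn_self (f : ℝ → V) (a : ℝ) : leftLimIn f a a = f a := by
  simp [leftLimIn]

namespace IsCadlagOn

variable {f : ℝ → V} {a b : ℝ}

theorem tendsto_leftLimIn (hf : IsCadlagOn f a b) {t : ℝ} (ht : t ∈ Ioc a b) :
    Tendsto f (𝓝[<] t) (𝓝 (leftLimIn f a t)) := by
  obtain ⟨l, hl⟩ := hf.2 t ht
  rw [nhdsWithin_Ico_eq_nhdsLT ht.1] at hl
  rwa [leftLimIn, if_pos ht.1, leftLim_eq_of_tendsto hl]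

/-- A closed bound valid for `f` near `t` from the left is also valid for its left limits. -/
theorem leftLimIn_mem (hf : IsCadlagOn f a b) {s : Set V} (hs : IsClosed s) {x y : ℝ}
    (hax : a ≤ x) (hyb : y ≤ b) (h : ∀ t ∈ Ioo x y, f t ∈ s) {t : ℝ} (ht : t ∈ Ioo x y) :
    leftLimIn f a t ∈ s := by
  refine hs.mem_of_tendsto
    (hf.tendsto_leftLimIn ⟨hax.trans_lt ht.1, ht.2.le.trans hyb⟩) ?_
  filter_upwards [Ioo_mem_nhdsLT ht.1] with z hz
  exact h z ⟨hz.1, hz.2.trans ht.2⟩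

theorem exists_left (hf : IsCadlagOn f a b) {t : ℝ} (ht : t ∈ Ioc a b) {ε : ℝ} (hε : 0 < ε) :
    ∃ x < t, a ≤ x ∧ ∀ z ∈ Ioo x t, f z ∈ Metric.closedBall (leftLimIn f a t) ε ∧
      leftLimIn f a z ∈ Metric.closedBall (leftLimIn f a t) ε := by
  have h := (hf.tendsto_leftLimIn ht).eventually (Metric.closedBall_mem_nhds _ hε)
  obtain ⟨x, hx, hsub⟩ := (mem_nhdsLT_iff_exists_Ioo_subset' ht.1).1 h
  have hsub' : ∀ z ∈ Ioo (max a x) t, f z ∈ Metric.closedBall (leftLimIn f a t) ε :=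
    fun z hz => hsub ⟨(le_max_right _ _).trans_lt hz.1, hz.2⟩
  exact ⟨max a x, max_lt ht.1 hx, le_max_left _ _, fun z hz => ⟨hsub' z hz,
    hf.leftLimIn_mem Metric.isClosed_closedBall (le_max_left _ _) ht.2 hsub' hz⟩⟩

theorem exists_right (hf : IsCadlagOn f a b) {t : ℝ} (ht : t ∈ Ico a b) {ε : ℝ} (hε : 0 < ε) :
    ∃ y > t, y ≤ b ∧ ∀ z ∈ Ioo t y, f z ∈ Metric.closedBall (f t) ε ∧
      leftLimIn f a z ∈ Metric.closedBall (f t) ε := by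
  have h := hf.1 t ht
  rw [nhdsWithin_Ioc_eq_nhdsGT ht.2] at h
  obtain ⟨y, hy, hsub⟩ := (mem_nhdsGT_iff_exists_Ioo_subset' ht.2).1
    (h.eventually (Metric.closedBall_mem_nhds _ hε))
  have hsub' : ∀ z ∈ Ioo t (min b y), f z ∈ Metric.closedBall (f t) ε :=
    fun z hz => hsub ⟨hz.1, hz.2.trans_le (min_le_right _ _)⟩
  exact ⟨min b y, lt_min ht.2 hy, min_le_left _ _, fun z hz => ⟨hsub' z hz,
    hf.leftLimIn_mem Metric.isClosed_closedBall ht.1 (min_le_left _ _) hsub' hz⟩⟩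

theorem countable_jumps (hf : IsCadlagOn f a b) :
    {t | t ∈ Icc a b ∧ leftLimIn f a t ≠ f t}.Countable := by
  have key (ε : ℝ) (hε : 0 < ε) :
      {t | t ∈ Ioc a b ∧ 2 * ε < dist (f t) (leftLimIn f a t)}.Countable := by
    choose! x hx _ hxt using fun t (ht : t ∈ Ioc a b) => hf.exists_left ht hε
    refine PairwiseDisjoint.countable_of_isOpen (s := fun t => Ioo (x t) t) ?_
      (fun _ _ => isOpen_Ioo) fun t ht => nonempty_Ioo.2 (hx t ht.1)
    have hdisj : ∀ t ∈ {t | t ∈ Ioc a b ∧ 2 * ε < dist (f t) (leftLimIn f a t)},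
        ∀ t' ∈ {t | t ∈ Ioc a b ∧ 2 * ε < dist (f t) (leftLimIn f a t)}, t < t' →
          Disjoint (Ioo (x t) t) (Ioo (x t') t') := by
      intro t ht t' ht' hlt
      rw [Set.disjoint_left]
      intro z hz hz'
      obtain ⟨h1, h2⟩ := hxt t' ht'.1 t ⟨hz'.1.trans hz.2, hlt⟩
      have := dist_triangle_right (f t) (leftLimIn f a t) (leftLimIn f a t')
      rw [Metric.mem_closedBall] at h1 h2
      linarith [ht.2]
    intro t ht t' ht' hne
    rcases hne.lt_or_gt with h | h
    · exact hdisj t ht t' ht' h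
    · exact (hdisj t' ht' t ht h).symm
  refine (countable_iUnion fun n : ℕ => key (1 / (n + 1)) (by positivity)).mono ?_
  rintro t ⟨ht, hne⟩
  have hat : a < t := ht.1.lt_of_ne (by rintro rfl; exact hne (leftLimIn_self f a))
  have hd : 0 < dist (f t) (leftLimIn f a t) / 2 := half_pos (dist_pos.2 hne.symm)
  obtain ⟨n, hn⟩ := exists_nat_one_div_lt hd
  exact mem_iUnion.2 ⟨n, ⟨hat, ht.2⟩, by linarith⟩

end IsCadlagOn

variable [NormedSpace ℝ V]

theorem norm_sub_segment (v w : V) {c : ℝ} (hc : c ≤ 1) :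
    ‖v - (c • v + (1 - c) • w)‖ = (1 - c) * ‖v - w‖ := by
  have : v - (c • v + (1 - c) • w) = (1 - c) • (v - w) := by module
  rw [this, norm_smul, Real.norm_of_nonneg (by linarith)]

/-- Fraction of the jump interval `[φm t, φ t]` of a clock lying to the right of `s`. -/
noncomputable def jumpFraction (φm φ : ℝ → ℝ) (t s : ℝ) : ℝ :=
  max 0 (min 1 ((φ t - s) / (φ t - φm t)))

theorem jumpFraction_mem (φm φ : ℝ → ℝ) (t s : ℝ) : jumpFraction φm φ t s ∈ Icc (0 : ℝ) 1 :=
  ⟨le_max_left _ _, max_le zero_le_one (min_le_left _ _)⟩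

theorem continuous_jumpFraction (φm φ : ℝ → ℝ) (t : ℝ) : Continuous (jumpFraction φm φ t) := by
  unfold jumpFraction
  fun_prop

namespace JumpClock

variable {J : Set ℝ} {T : ℝ} {φm φ : ℝ → ℝ}

theorem jumpFraction_antitone (h : JumpClock J T φm φ) (t : ℝ) :
    Antitone (jumpFraction φm φ t) := by
  intro s s' hs
  have : 0 ≤ φ t - φm t := sub_nonneg.2 (h.le t)
  unfold jumpFraction
  gcongr

theorem jumpFraction_of_mem (h : JumpClock J T φm φ) {t s : ℝ}
    (hs : s ∈ Icc (φm t) (φ t)) : jumpFraction φm φ t s = (φ t - s) / (φ t - φm t) := by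
  have h0 : 0 ≤ φ t - φm t := sub_nonneg.2 (h.le t)
  rw [jumpFraction, min_eq_right (div_le_one_of_le₀ (by linarith [hs.1]) h0),
    max_eq_right (div_nonneg (by linarith [hs.2]) h0)]

theorem jumpFraction_left (h : JumpClock J T φm φ) {t s : ℝ} (ht : t ∈ J) (hs : s ≤ φm t) :
    jumpFraction φm φ t s = 1 := by
  have h0 : 0 < φ t - φm t := sub_pos.2 (h.lt t ht)
  rw [jumpFraction, min_eq_left ((one_le_div h0).2 (by linarith)), max_eq_right zero_le_one]

theorem jumpFraction_right (h : JumpClock J T φm φ) {t s : ℝ} (hs : φ t ≤ s) :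
    jumpFraction φm φ t s = 0 := by
  have h0 : 0 ≤ φ t - φm t := sub_nonneg.2 (h.le t)
  exact max_eq_left ((min_le_right _ _).trans
    (div_nonpos_of_nonpos_of_nonneg (by linarith) h0))

end JumpClock

/-- The point of the segment `[f(t−), f(t)]` reached by the clock at time `s`. -/
noncomputable def jumpPoint (f : ℝ → V) (φm φ : ℝ → ℝ) (t s : ℝ) : V :=
  jumpFraction φm φ t s • leftLimIn f 0 t + (1 - jumpFraction φm φ t s) • f t

theorem jumpPoint_of_eq (f : ℝ → V) (φm φ : ℝ → ℝ) {t : ℝ} (h : leftLimIn f 0 t = f t) (s : ℝ) :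
    jumpPoint f φm φ t s = f t := by
  rw [jumpPoint, h]
  module

theorem jumpPoint_mem {f : ℝ → V} {φm φ : ℝ → ℝ} {t s : ℝ} {S : Set V} (hS : Convex ℝ S)
    (h : f t ∈ S) (h' : leftLimIn f 0 t ∈ S) : jumpPoint f φm φ t s ∈ S := by
  have := jumpFraction_mem φm φ t s
  exact hS h' h this.1 (sub_nonneg.2 this.2) (by ring)

/-- Every càdlàg function has an injective parametric representation. -/
theorem IsCadlagOn.exists_isParamRep_injOn {f : ℝ → V} {T : ℝ} (hT : 0 < T)
    (hf : IsCadlagOn f 0 T) :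
    ∃ r u, IsParamRep f 0 T r u ∧ InjOn (fun s => (r s, u s)) (Icc (0 : ℝ) 1) := by
  obtain ⟨φm, φ, h⟩ := exists_jumpClock hf.countable_jumps hT
  set J := {t | t ∈ Icc 0 T ∧ leftLimIn f 0 t ≠ f t}
  have hnJ : ∀ t ∈ Icc 0 T, t ∉ J → leftLimIn f 0 t = f t := fun t ht h' => by
    by_contra hne
    exact h' ⟨ht, hne⟩
  choose! r hr hrs using fun s (hs : s ∈ Icc (0 : ℝ) 1) => h.exists_mem hT hs
  have hr_eq : ∀ t ∈ Icc 0 T, ∀ s ∈ Icc (φm t) (φ t), r s = t := fun t ht s hs =>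
    le_antisymm (h.le_of_mem (hrs s (h.Icc_subset ht hs)) hs le_rfl)
      (h.le_of_mem hs (hrs s (h.Icc_subset ht hs)) le_rfl)
  have h0J : leftLimIn f 0 0 = f 0 := leftLimIn_self f 0
  have h00 : (0 : ℝ) ∈ Icc (φm 0) (φ 0) := ⟨h.zero.le, h.zero.symm.le.trans (h.le 0)⟩
  have h1T : (1 : ℝ) ∈ Icc (φm T) (φ T) := ⟨(h.le T).trans h.one.le, h.one.ge⟩
  have hr0 : r 0 = 0 := hr_eq 0 ⟨le_rfl, hT.le⟩ 0 h00
  have hr1 : r 1 = T := hr_eq T ⟨hT.le, le_rfl⟩ 1 h1T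
  set u : ℝ → V := fun s => jumpPoint f φm φ (r s) s with hu
  have hlt_of_lt : ∀ s ∈ Icc (0 : ℝ) 1, ∀ t, φ t < s → t < r s := by
    intro s hs t hts
    by_contra! hle
    have h1 := (hrs s hs).2
    rcases hle.eq_or_lt with h2 | h2
    · rw [h2] at h1; linarith
    · linarith [h.strict _ _ h2, h.le t]
  have hgt_of_lt : ∀ s ∈ Icc (0 : ℝ) 1, ∀ t, s < φm t → r s < t := by
    intro s hs t hts
    by_contra! hle
    have h1 := (hrs s hs).1
    rcases hle.eq_or_lt with h2 | h2
    · rw [← h2] at h1; linarith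
    · linarith [h.strict _ _ h2, h.le t]
  have hrev : ∀ s ∈ Icc (0 : ℝ) 1, ∀ x, x < r s → ∀ᶠ z in 𝓝[Icc 0 1] s, x < r z := by
    intro s hs x hx
    have hφ : φ x < s := (h.strict _ _ hx).trans_le (hrs s hs).1
    filter_upwards [self_mem_nhdsWithin, nhdsWithin_le_nhds (Ioi_mem_nhds hφ)] with z hz hz'
    exact hlt_of_lt z hz x hz'
  have hrev' : ∀ s ∈ Icc (0 : ℝ) 1, ∀ x, r s < x → ∀ᶠ z in 𝓝[Icc 0 1] s, r z < x := by
    intro s hs x hx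
    have hφ : s < φm x := (hrs s hs).2.trans_lt (h.strict _ _ hx)
    filter_upwards [self_mem_nhdsWithin, nhdsWithin_le_nhds (Iio_mem_nhds hφ)] with z hz hz'
    exact hgt_of_lt z hz x hz'
  have hrc : ContinuousOn r (Icc 0 1) := fun s hs =>
    tendsto_order.2 ⟨hrev s hs, hrev' s hs⟩
  have huc : ContinuousOn u (Icc 0 1) := by
    intro s hs
    rw [ContinuousWithinAt, Metric.tendsto_nhds]
    intro ε hε
    have hp : Continuous fun z => jumpPoint f φm φ (r s) z := by
      have := continuous_jumpFraction φm φ (r s)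
      unfold jumpPoint
      fun_prop
    have hp' := nhdsWithin_le_nhds (s := Icc 0 1)
      (hp.continuousAt.eventually (Metric.ball_mem_nhds (u s) (half_pos hε)))
    have hleft : ∀ᶠ z in 𝓝[Icc 0 1] s, r z < r s →
        dist (u z) (jumpPoint f φm φ (r s) z) ≤ ε / 2 := by
      rcases (hr s hs).1.eq_or_lt with h0 | h0
      · filter_upwards [self_mem_nhdsWithin] with z hz hlt
        exact absurd hlt (by rw [← h0]; exact (hr z hz).1.not_gt)
      · obtain ⟨x, hx, -, hxs⟩ := hf.exists_left ⟨h0, (hr s hs).2⟩ (half_pos hε)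
        filter_upwards [self_mem_nhdsWithin, hrev s hs x hx] with z hz hxz hlt
        obtain ⟨h1, h2⟩ := hxs (r z) ⟨hxz, hlt⟩
        have hle : z ≤ φm (r s) := (hrs z hz).2.trans (h.strict _ _ hlt).le
        have hpz : jumpPoint f φm φ (r s) z = leftLimIn f 0 (r s) := by
          by_cases hj : r s ∈ J
          · rw [jumpPoint, h.jumpFraction_left hj hle]
            module
          · rw [jumpPoint_of_eq _ _ _ (hnJ _ (hr s hs) hj), hnJ _ (hr s hs) hj]
        rw [hpz]
        exact Metric.mem_closedBall.1 (jumpPoint_mem (convex_closedBall _ _) h1 h2)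
    have hright : ∀ᶠ z in 𝓝[Icc 0 1] s, r s < r z →
        dist (u z) (jumpPoint f φm φ (r s) z) ≤ ε / 2 := by
      rcases (hr s hs).2.eq_or_lt with h0 | h0
      · filter_upwards [self_mem_nhdsWithin] with z hz hlt
        exact absurd hlt (by rw [h0]; exact (hr z hz).2.not_gt)
      · obtain ⟨x, hx, -, hxs⟩ := hf.exists_right ⟨(hr s hs).1, h0⟩ (half_pos hε)
        filter_upwards [self_mem_nhdsWithin, hrev' s hs x hx] with z hz hxz hlt
        obtain ⟨h1, h2⟩ := hxs (r z) ⟨hlt, hxz⟩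
        have hle : φ (r s) ≤ z := (h.strict _ _ hlt).le.trans (hrs z hz).1
        have hpz : jumpPoint f φm φ (r s) z = f (r s) := by
          rw [jumpPoint, h.jumpFraction_right hle]
          module
        rw [hpz]
        exact Metric.mem_closedBall.1 (jumpPoint_mem (convex_closedBall _ _) h1 h2)
    filter_upwards [hp', hleft, hright] with z hz1 hz2 hz3
    have h4 : dist (u z) (jumpPoint f φm φ (r s) z) ≤ ε / 2 := by
      rcases lt_trichotomy (r z) (r s) with h5 | h5 | h5
      · exact hz2 h5
      · simp only [hu, h5, dist_self]
        exact (half_pos hε).le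
      · exact hz3 h5
    have := dist_triangle (u z) (jumpPoint f φm φ (r s) z) (u s)
    linarith
  refine ⟨r, u, ⟨hrc.prodMk huc, fun s hs => ⟨hr s hs, _, jumpFraction_mem φm φ (r s) s, rfl⟩,
    ?_, ?_, ⟨hr0, ?_⟩, ⟨hr1, ?_⟩⟩, ?_⟩
  · rintro ⟨t, v⟩ ⟨ht, α, hα, hv⟩
    simp only at ht hv
    have hle := h.le t
    have hs : α * φm t + (1 - α) * φ t ∈ Icc (φm t) (φ t) :=
      ⟨by nlinarith [hα.1, hα.2], by nlinarith [hα.1, hα.2]⟩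
    refine ⟨_, h.Icc_subset ht hs, Prod.ext (hr_eq t ht _ hs) ?_⟩
    simp only [hu, hr_eq t ht _ hs, hv]
    by_cases hj : t ∈ J
    · have hne : φ t - φm t ≠ 0 := (sub_pos.2 (h.lt t hj)).ne'
      have : jumpFraction φm φ t (α * φm t + (1 - α) * φ t) = α := by
        rw [h.jumpFraction_of_mem hs]
        field_simp
        ring
      rw [jumpPoint, this]
    · rw [jumpPoint_of_eq _ _ _ (hnJ t ht hj), hnJ t ht hj]
      module
  · intro s hs s' hs' hle
    rcases (h.le_of_mem (hrs s hs) (hrs s' hs') hle).lt_or_eq with hlt | heq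
    · exact Or.inl hlt
    · refine Or.inr ⟨heq, ?_⟩
      simp only [hu, ← heq, jumpPoint]
      rw [norm_sub_segment _ _ (jumpFraction_mem _ _ _ _).2,
        norm_sub_segment _ _ (jumpFraction_mem _ _ _ _).2]
      have := h.jumpFraction_antitone (r s) hle
      gcongr
  · simp only [hu, hr0]
    exact jumpPoint_of_eq _ _ _ h0J _
  · simp only [hu, hr1, jumpPoint]
    rw [h.jumpFraction_right h.one.le]
    module
  · intro s hs s' hs' heq
    obtain ⟨h1, h2⟩ := Prod.ext_iff.1 heq
    simp only at h1 h2
    have hms := hrs s hs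
    have hms' := hrs s' hs'
    rw [← h1] at hms'
    by_cases hj : r s ∈ J
    · have hne : 0 < ‖leftLimIn f 0 (r s) - f (r s)‖ := norm_pos_iff.2 (sub_ne_zero.2 hj.2)
      have h3 : ‖leftLimIn f 0 (r s) - u s‖ = ‖leftLimIn f 0 (r s) - u s'‖ := by rw [h2]
      simp only [hu, ← h1, jumpPoint] at h3
      rw [norm_sub_segment _ _ (jumpFraction_mem _ _ _ _).2,
        norm_sub_segment _ _ (jumpFraction_mem _ _ _ _).2, mul_left_inj' hne.ne',
        h.jumpFraction_of_mem hms, h.jumpFraction_of_mem hms'] at h3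
      have := sub_pos.2 (h.lt _ hj)
      field_simp at h3
      linarith
    · have := h.eq _ hj
      linarith [hms.1, hms.2, hms'.1, hms'.2]

end

section

open Filter Set Topology

/-- A continuous nondecreasing map of `[0, 1]` onto itself. -/
structure IsRepar (μ : ℝ → ℝ) : Prop where
  contOn : ContinuousOn μ (Icc 0 1)
  mono : MonotoneOn μ (Icc 0 1)
  zero : μ 0 = 0
  one : μ 1 = 1

namespace IsRepar

variable {μ : ℝ → ℝ}

theorem mapsTo (h : IsRepar μ) : MapsTo μ (Icc 0 1) (Icc 0 1) := fun _ hs =>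
  ⟨h.zero.symm.le.trans (h.mono ⟨le_rfl, zero_le_one⟩ hs hs.1),
    (h.mono hs ⟨zero_le_one, le_rfl⟩ hs.2).trans h.one.le⟩

theorem surjOn (h : IsRepar μ) : SurjOn μ (Icc 0 1) (Icc 0 1) := by
  have := intermediate_value_Icc zero_le_one h.contOn
  rwa [h.zero, h.one] at this

end IsRepar

theorem continuousOn_of_comp_injOn {X : Type*} [TopologicalSpace X] [T2Space X] {K : Set ℝ}
    (hK : IsCompact K) {h k : ℝ → X} {μ : ℝ → ℝ} (hc : ContinuousOn h K) (hi : InjOn h K)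
    (kc : ContinuousOn k K) (hμ : MapsTo μ K K) (heq : ∀ s ∈ K, h (μ s) = k s) :
    ContinuousOn μ K := by
  have := isCompact_iff_compactSpace.1 hK
  have hemb := hc.domRestrict.isClosedEmbedding hi.injective
  have hμ' : Continuous (hμ.restrict μ K K) := by
    rw [hemb.isInducing.continuous_iff]
    have : K.domRestrict h ∘ hμ.restrict μ K K = K.domRestrict k := funext fun s => heq s s.2
    rw [this]
    exact kc.domRestrict
  exact continuousOn_iff_continuous_domRestrict.2 (continuous_subtype_val.comp hμ')

theorem IsRepar.exists_rightInverse {μ : ℝ → ℝ} (h : IsRepar μ)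
    (hs : StrictMonoOn μ (Icc 0 1)) :
    ∃ ν, IsRepar ν ∧ ∀ s ∈ Icc (0 : ℝ) 1, μ (ν s) = s := by
  choose! ν hν hμν using h.surjOn
  have h0 : (0 : ℝ) ∈ Icc (0 : ℝ) 1 := ⟨le_rfl, zero_le_one⟩
  have h1 : (1 : ℝ) ∈ Icc (0 : ℝ) 1 := ⟨zero_le_one, le_rfl⟩
  refine ⟨ν, ⟨continuousOn_of_comp_injOn isCompact_Icc h.contOn hs.injOn continuousOn_id hν
    fun _ hx => hμν hx, fun s h2 s' h3 hle => ?_, ?_, ?_⟩, fun _ hx => hμν hx⟩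
  · rwa [← hs.le_iff_le (hν h2) (hν h3), hμν h2, hμν h3]
  · exact hs.injOn (hν h0) h0 ((hμν h0).trans h.zero.symm)
  · exact hs.injOn (hν h1) h1 ((hμν h1).trans h.one.symm)

variable {V : Type*} [NormedAddCommGroup V] [NormedSpace ℝ V]

theorem graphLE_antisymm {f : ℝ → V} {a b : ℝ} {p q : ℝ × V} (hp : p ∈ extGraph f a b)
    (hq : q ∈ extGraph f a b) (h : graphLE f a p q) (h' : graphLE f a q p) : p = q := by
  obtain ⟨t, v⟩ := p
  obtain ⟨t', v'⟩ := q
  obtain ⟨-, α, hα, hv⟩ := hp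
  obtain ⟨-, β, hβ, hv'⟩ := hq
  simp only [graphLE] at h h' hv hv'
  have ht : t = t' := by
    rcases h with h | ⟨h, -⟩
    · rcases h' with h' | ⟨h', -⟩
      · exact absurd h' h.not_gt
      · exact h'.symm
    · exact h
  subst ht
  simp only [lt_irrefl, true_and, false_or] at h h'
  have heq := le_antisymm h h'
  rw [hv, hv', norm_sub_segment _ _ hα.2, norm_sub_segment _ _ hβ.2] at heq
  refine Prod.ext rfl ?_
  simp only [hv, hv']
  rcases mul_eq_mul_right_iff.1 heq with h1 | h1
  · rw [show α = β by linarith]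
  · rw [← sub_eq_zero.1 (norm_eq_zero.1 h1)]
    module

namespace IsParamRep

variable {f g : ℝ → V} {a b : ℝ} {r r' : ℝ → ℝ} {u u' : ℝ → V}

theorem comp (h : IsParamRep f a b r u) {μ : ℝ → ℝ} (hμ : IsRepar μ) :
    IsParamRep f a b (r ∘ μ) (u ∘ μ) where
  contOn := h.contOn.comp hμ.contOn hμ.mapsTo
  mem s hs := h.mem _ (hμ.mapsTo hs)
  surj p hp := by
    obtain ⟨s, hs, rfl⟩ := h.surj p hp
    obtain ⟨s', hs', rfl⟩ := hμ.surjOn hs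
    exact ⟨s', hs', rfl⟩
  mono s hs s' hs' hle := h.mono _ (hμ.mapsTo hs) _ (hμ.mapsTo hs') (hμ.mono hs hs' hle)
  init := by simpa [hμ.zero] using h.init
  last := by simpa [hμ.one] using h.last

/-- Every parametric representation factors through an injective one. -/
theorem exists_factor (h : IsParamRep f a b r u) (h' : IsParamRep f a b r' u')
    (hi : InjOn (fun s => (r' s, u' s)) (Icc (0 : ℝ) 1)) :
    ∃ μ, IsRepar μ ∧ ∀ s ∈ Icc (0 : ℝ) 1, (r' (μ s), u' (μ s)) = (r s, u s) := by
  choose! μ hμ hμs using fun s hs => h'.surj _ (h.mem s hs)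
  have h0 : (0 : ℝ) ∈ Icc (0 : ℝ) 1 := ⟨le_rfl, zero_le_one⟩
  have h1 : (1 : ℝ) ∈ Icc (0 : ℝ) 1 := ⟨zero_le_one, le_rfl⟩
  refine ⟨μ, ⟨continuousOn_of_comp_injOn isCompact_Icc h'.contOn hi h.contOn hμ hμs,
    fun s hs s' hs' hle => ?_, ?_, ?_⟩, hμs⟩
  · by_contra! hlt
    have h2 := h'.mono _ (hμ s' hs') _ (hμ s hs) hlt.le
    rw [hμs s hs, hμs s' hs'] at h2
    have h3 := graphLE_antisymm (h.mem s hs) (h.mem s' hs') (h.mono s hs s' hs' hle) h2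
    rw [← hμs s hs, ← hμs s' hs'] at h3
    exact hlt.ne' (hi (hμ s hs) (hμ s' hs') h3)
  · refine hi (hμ 0 h0) h0 ((hμs 0 h0).trans ?_)
    simp only [h.init, h'.init]
  · refine hi (hμ 1 h1) h1 ((hμs 1 h1).trans ?_)
    simp only [h.last, h'.last]

/-- Any parametric representation can be reparametrised to be uniformly close to a given
injective one. -/
theorem exists_repar_dist_le (h : IsParamRep f a b r u) (h' : IsParamRep f a b r' u')
    (hi : InjOn (fun s => (r' s, u' s)) (Icc (0 : ℝ) 1)) {ε : ℝ} (hε : 0 < ε) :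
    ∃ μ, IsRepar μ ∧ ∀ s ∈ Icc (0 : ℝ) 1, dist (r (μ s), u (μ s)) (r' s, u' s) ≤ ε := by
  obtain ⟨l, hl, hls⟩ := h.exists_factor h' hi
  obtain ⟨δ, hδ, hδε⟩ := Metric.uniformContinuousOn_iff_le.1
    (isCompact_Icc.uniformContinuousOn_of_continuous h'.contOn) ε hε
  set η := min δ 1
  have hη0 : 0 < η := lt_min hδ one_pos
  have hη1 : η ≤ 1 := min_le_right _ _
  set l' : ℝ → ℝ := fun s => (1 - η) * l s + η * s with hl'
  have hrep : IsRepar l' := by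
    refine ⟨?_, fun s hs s' hs' hle => ?_, by simp [hl', hl.zero], by simp [hl', hl.one]⟩
    · have := hl.contOn
      fun_prop
    · have := hl.mono hs hs' hle
      have : 0 ≤ 1 - η := sub_nonneg.2 hη1
      simp only [hl']
      gcongr
  have hstrict : StrictMonoOn l' (Icc 0 1) := by
    intro s hs s' hs' hlt
    have := hl.mono hs hs' hlt.le
    have : 0 ≤ 1 - η := sub_nonneg.2 hη1
    exact add_lt_add_of_le_of_lt (by gcongr) (by gcongr)
  obtain ⟨μ, hμ, hμs⟩ := hrep.exists_rightInverse hstrict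
  refine ⟨μ, hμ, fun s hs => ?_⟩
  have hm := hμ.mapsTo hs
  have hlm := hl.mapsTo hm
  rw [← hls _ hm]
  refine hδε _ hlm _ hs ?_
  have h4 : (1 - η) * l (μ s) + η * μ s = s := hμs s hs
  have h6 : l (μ s) - s = η * (l (μ s) - μ s) := by linear_combination h4
  rw [Real.dist_eq, h6, abs_mul, abs_of_pos hη0]
  have h5 : |l (μ s) - μ s| ≤ 1 := by
    rw [abs_le]
    constructor <;> linarith [hlm.1, hlm.2, hm.1, hm.2]
  calc η * |l (μ s) - μ s| ≤ η * 1 := by gcongr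
    _ ≤ δ := by rw [mul_one]; exact min_le_left _ _

theorem bddAbove_abs_sub (h : IsParamRep f a b r u) (h' : IsParamRep g a b r' u') :
    BddAbove (range fun s : Icc (0 : ℝ) 1 => |r s.1 - r' s.1|) := by
  have : ContinuousOn (fun s => |r s - r' s|) (Icc 0 1) :=
    (h.contOn.fst.sub h'.contOn.fst).abs
  have := isCompact_Icc.bddAbove_image this
  rwa [image_eq_range] at this

theorem bddAbove_norm_sub (h : IsParamRep f a b r u) (h' : IsParamRep g a b r' u') :
    BddAbove (range fun s : Icc (0 : ℝ) 1 => ‖u s.1 - u' s.1‖) := by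
  have : ContinuousOn (fun s => ‖u s - u' s‖) (Icc 0 1) :=
    (h.contOn.snd.sub h'.contOn.snd).norm
  have := isCompact_Icc.bddAbove_image this
  rwa [image_eq_range] at this

end IsParamRep

variable {f g h : ℝ → V} {a b T : ℝ}

theorem dM_nonneg (a b : ℝ) (f g : ℝ → V) : 0 ≤ dM a b f g := by
  refine Real.sInf_nonneg ?_
  rintro d ⟨r, u, r', u', -, -, rfl⟩
  exact (Real.iSup_nonneg fun s => abs_nonneg _).trans (le_max_left _ _)

theorem dM_comm (a b : ℝ) (f g : ℝ → V) : dM a b f g = dM a b g f := by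
  unfold dM
  congr 1
  ext d
  constructor <;>
  · rintro ⟨r, u, r', u', h, h', rfl⟩
    exact ⟨r', u', r, u, h', h, by simp only [abs_sub_comm, norm_sub_rev]⟩

theorem dM_le {r r' : ℝ → ℝ} {u u' : ℝ → V} (h : IsParamRep f a b r u)
    (h' : IsParamRep g a b r' u') {c : ℝ}
    (hc : ∀ s ∈ Icc (0 : ℝ) 1, dist (r s, u s) (r' s, u' s) ≤ c) : dM a b f g ≤ c := by
  have : Nonempty (Icc (0 : ℝ) 1) := ⟨0, le_rfl, zero_le_one⟩
  unfold dM
  refine csInf_le_of_le (b := max (⨆ s : Icc (0 : ℝ) 1, |r s.1 - r' s.1|)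
    (⨆ s : Icc (0 : ℝ) 1, ‖u s.1 - u' s.1‖)) ⟨0, ?_⟩
    (by exact ⟨r, u, r', u', h, h', rfl⟩) (max_le (ciSup_le fun s => ?_) (ciSup_le fun s => ?_))
  · rintro d ⟨r, u, r', u', -, -, rfl⟩
    exact (Real.iSup_nonneg fun s => abs_nonneg _).trans (le_max_left _ _)
  · exact (le_max_left _ _).trans (hc s s.2)
  · rw [← dist_eq_norm]
    exact (le_max_right _ _).trans (hc s s.2)

theorem exists_of_dM_lt (hT : 0 < T) (hf : IsCadlagOn f 0 T) (hg : IsCadlagOn g 0 T) {c : ℝ}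
    (hc : dM 0 T f g < c) :
    ∃ r u r' u', IsParamRep f 0 T r u ∧ IsParamRep g 0 T r' u' ∧
      ∀ s ∈ Icc (0 : ℝ) 1, dist (r s, u s) (r' s, u' s) ≤ c := by
  obtain ⟨r₀, u₀, h₀, -⟩ := hf.exists_isParamRep_injOn hT
  obtain ⟨r₁, u₁, h₁, -⟩ := hg.exists_isParamRep_injOn hT
  unfold dM at hc
  obtain ⟨d, ⟨r, u, r', u', h, h', rfl⟩, hd⟩ :=
    exists_lt_of_csInf_lt (by exact ⟨_, r₀, u₀, r₁, u₁, h₀, h₁, rfl⟩) hc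
  refine ⟨r, u, r', u', h, h', fun s hs => ?_⟩
  obtain ⟨hd1, hd2⟩ := max_lt_iff.1 hd
  rw [Prod.dist_eq]
  refine max_le ?_ ?_
  · exact (le_ciSup (h.bddAbove_abs_sub h') ⟨s, hs⟩).trans hd1.le
  · simp only [dist_eq_norm]
    exact (le_ciSup (h.bddAbove_norm_sub h') ⟨s, hs⟩).trans hd2.le

theorem dM_triangle (hT : 0 < T) (hf : IsCadlagOn f 0 T) (hg : IsCadlagOn g 0 T)
    (hh : IsCadlagOn h 0 T) : dM 0 T f h ≤ dM 0 T f g + dM 0 T g h := by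
  refine le_of_forall_pos_le_add fun ε hε => ?_
  have hε4 : 0 < ε / 4 := by positivity
  obtain ⟨r₁, u₁, r₂, u₂, h₁, h₂, h₁₂⟩ :=
    exists_of_dM_lt hT hf hg (lt_add_of_pos_right _ hε4)
  obtain ⟨r₃, u₃, r₄, u₄, h₃, h₄, h₃₄⟩ :=
    exists_of_dM_lt hT hg hh (lt_add_of_pos_right _ hε4)
  obtain ⟨r, u, h₀, hi⟩ := hg.exists_isParamRep_injOn hT
  obtain ⟨μ, hμ, hμs⟩ := h₂.exists_repar_dist_le h₀ hi hε4
  obtain ⟨ν, hν, hνs⟩ := h₃.exists_repar_dist_le h₀ hi hε4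
  refine dM_le (h₁.comp hμ) (h₄.comp hν) fun s hs => ?_
  have e1 := h₁₂ _ (hμ.mapsTo hs)
  have e2 := h₃₄ _ (hν.mapsTo hs)
  have e3 := hμs s hs
  have e4 := hνs s hs
  rw [dist_comm] at e4
  have e5 := dist_triangle4 (r₁ (μ s), u₁ (μ s)) (r₂ (μ s), u₂ (μ s)) (r s, u s)
    (r₄ (ν s), u₄ (ν s))
  have e6 := dist_triangle (r s, u s) (r₃ (ν s), u₃ (ν s)) (r₄ (ν s), u₄ (ν s))
  simp only [Function.comp_apply]
  linarith

theorem eqOn_of_dM_eq_zero (hT : 0 < T) (hf : IsCadlagOn f 0 T) (hg : IsCadlagOn g 0 T)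
    (h0 : dM 0 T f g = 0) : EqOn f g (Icc 0 T) := by
  intro t ht
  refine eq_of_dist_eq_zero (le_antisymm (le_of_forall_pos_le_add fun ε hε => ?_) dist_nonneg)
  rw [zero_add]
  rcases ht.2.eq_or_lt with rfl | htT
  · obtain ⟨r, u, r', u', h, h', hd⟩ := exists_of_dM_lt hT hf hg (h0.trans_lt hε)
    have := (le_max_right _ _).trans (hd 1 ⟨zero_le_one, le_rfl⟩)
    simpa only [h.last.2, h'.last.2] using this
  · have hε3 : 0 < ε / 3 := by positivity
    obtain ⟨x, hx, hxT, hfx⟩ := hf.exists_right ⟨ht.1, htT⟩ hε3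
    obtain ⟨y, hy, hyT, hgy⟩ := hg.exists_right ⟨ht.1, htT⟩ hε3
    set δ := min x y - t
    have hδ0 : 0 < δ := sub_pos.2 (lt_min hx hy)
    have hδx : t + δ ≤ x := by linarith [min_le_left x y]
    have hδy : t + δ ≤ y := by linarith [min_le_right x y]
    have hc : 0 < min (ε / 3) (δ / 4) := by positivity
    obtain ⟨r, u, r', u', h, h', hd⟩ := exists_of_dM_lt hT hf hg (h0.trans_lt hc)
    have hmem : (t + δ / 2, f (t + δ / 2)) ∈ extGraph f 0 T :=
      ⟨⟨by simp only; linarith [ht.1], by simp only; linarith⟩, 0, ⟨le_rfl, zero_le_one⟩,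
        by simp⟩
    obtain ⟨s, hs, hsp⟩ := h.surj _ hmem
    have hds := hd s hs
    rw [hsp] at hds
    have hr : |t + δ / 2 - r' s| ≤ δ / 4 :=
      ((le_max_left _ _).trans hds).trans (min_le_right _ _)
    have hu : dist (f (t + δ / 2)) (u' s) ≤ ε / 3 :=
      ((le_max_right _ _).trans hds).trans (min_le_left _ _)
    rw [abs_le] at hr
    have hu' : u' s ∈ Metric.closedBall (g t) (ε / 3) := by
      obtain ⟨-, α, hα, hv⟩ := h'.mem s hs
      obtain ⟨h1, h2⟩ := hgy (r' s) ⟨by linarith, by linarith⟩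
      simp only at hv
      rw [hv]
      exact convex_closedBall _ _ h2 h1 hα.1 (sub_nonneg.2 hα.2) (by ring)
    have hf' := (hfx (t + δ / 2) ⟨by linarith, by linarith⟩).1
    rw [Metric.mem_closedBall] at hu' hf'
    rw [dist_comm] at hf'
    have := dist_triangle4 (f t) (f (t + δ / 2)) (u' s) (g t)
    linarith

theorem IsParamRep.congr {r : ℝ → ℝ} {u : ℝ → V} (hT : 0 < T) (hf : IsCadlagOn f 0 T)
    (hg : IsCadlagOn g 0 T) (heq : EqOn f g (Icc 0 T)) (h : IsParamRep f 0 T r u) :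
    IsParamRep g 0 T r u := by
  have hl : ∀ t ∈ Icc 0 T, leftLimIn f 0 t = leftLimIn g 0 t := by
    intro t ht
    rcases ht.1.eq_or_lt with rfl | h0
    · rw [leftLimIn_self, leftLimIn_self, heq ht]
    · refine tendsto_nhds_unique (hf.tendsto_leftLimIn ⟨h0, ht.2⟩)
        ((hg.tendsto_leftLimIn ⟨h0, ht.2⟩).congr' ?_)
      filter_upwards [Ioo_mem_nhdsLT h0] with s hs
      exact (heq ⟨hs.1.le, hs.2.le.trans ht.2⟩).symm
  have hΓ : extGraph f 0 T = extGraph g 0 T := by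
    ext p
    refine and_congr_right fun hp => ?_
    rw [hl _ hp, heq hp]
  refine ⟨h.contOn, hΓ ▸ h.mem, hΓ ▸ h.surj, fun s hs s' hs' hle => ?_, ?_, ?_⟩
  · have := h.mono s hs s' hs' hle
    rwa [graphLE, hl _ (h.mem s hs).1] at this
  · rw [← heq ⟨le_rfl, hT.le⟩]
    exact h.init
  · rw [← heq ⟨hT.le, le_rfl⟩]
    exact h.last

theorem dM_eq_zero_of_eqOn (hT : 0 < T) (hf : IsCadlagOn f 0 T) (hg : IsCadlagOn g 0 T)
    (heq : EqOn f g (Icc 0 T)) : dM 0 T f g = 0 := by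
  obtain ⟨r, u, h, -⟩ := hf.exists_isParamRep_injOn hT
  exact le_antisymm (dM_le h (h.congr hT hf hg heq) fun s _ => (dist_self _).le)
    (dM_nonneg _ _ _ _)

end

/-- on a separable real Banach space `V`, `d_M` is a metric on `D([0,T];V)`:
nonnegative (and real-valued, hence finite), symmetric, satisfying the triangle inequality,
and vanishing exactly on pairs of equal functions. -/
theorem dM_is_metric {V : Type*} [NormedAddCommGroup V] [NormedSpace ℝ V]
    [CompleteSpace V] [TopologicalSpace.SeparableSpace V]
    (T : ℝ) (hT : 0 < T) :
    (∀ f g : ℝ → V, IsCadlagOn f 0 T → IsCadlagOn g 0 T → 0 ≤ dM 0 T f g) ∧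
    (∀ f g : ℝ → V, IsCadlagOn f 0 T → IsCadlagOn g 0 T → dM 0 T f g = dM 0 T g f) ∧
    (∀ f g h : ℝ → V, IsCadlagOn f 0 T → IsCadlagOn g 0 T → IsCadlagOn h 0 T →
      dM 0 T f h ≤ dM 0 T f g + dM 0 T g h) ∧
    (∀ f g : ℝ → V, IsCadlagOn f 0 T → IsCadlagOn g 0 T →
      (dM 0 T f g = 0 ↔ Set.EqOn f g (Set.Icc 0 T))) := by
  exact ⟨fun f g _ _ => dM_nonneg 0 T f g, fun f g _ _ => dM_comm 0 T f g,
    fun f g h hf hg hh => dM_triangle hT hf hg hh, fun f g hf hg =>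
      ⟨eqOn_of_dM_eq_zero hT hf hg, dM_eq_zero_of_eqOn hT hf hg⟩⟩
end

section
/- Let V be a separable real Banach space and T > 0. The metric space (D([0,T];V), d_M) is separable. -/
/-- A continuous function has no jumps in its extended graph. -/
lemma leftLimIn_eq_of_continuousAt {V : Type*} [NormedAddCommGroup V]
    {g : ℝ → V} {a t : ℝ} (hg : ContinuousAt g t) (ht : a ≤ t) : leftLimIn g a t = g t := by
  unfold leftLimIn
  split_ifs with h
  · exact hg.continuousWithinAt.leftLim_eq
  · rw [le_antisymm ht (not_lt.mp h)]

/-- A continuous function composed with a continuous monotone time change is a parametric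
representation of its extended graph. -/
lemma Continuous.isParamRep {V : Type*} [NormedAddCommGroup V] [NormedSpace ℝ V]
    {g : ℝ → V} (hg : Continuous g) {a b : ℝ} {φ : ℝ → ℝ}
    (hφ : ContinuousOn φ (Set.Icc 0 1)) (hmono : MonotoneOn φ (Set.Icc 0 1))
    (h0 : φ 0 = a) (h1 : φ 1 = b) : IsParamRep g a b φ (g ∘ φ) where
  contOn := hφ.prodMk (hg.comp_continuousOn hφ)
  mem s hs := by
    have ha : a ≤ φ s := h0 ▸ hmono (by simp) hs hs.1
    have hb : φ s ≤ b := h1 ▸ hmono hs (by simp) hs.2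
    refine ⟨⟨ha, hb⟩, 0, by simp, by simp⟩
  surj := by
    rintro ⟨t, v⟩ ⟨ht, α, -, hv⟩
    dsimp only at ht hv
    rw [leftLimIn_eq_of_continuousAt hg.continuousAt ht.1, ← add_smul, add_sub_cancel,
      one_smul] at hv
    obtain ⟨s, hs, rfl⟩ := intermediate_value_Icc zero_le_one hφ (by rwa [h0, h1])
    exact ⟨s, hs, by simp [hv]⟩
  mono s₁ hs₁ s₂ hs₂ h := by
    rcases (hmono hs₁ hs₂ h).lt_or_eq with hlt | heq
    · exact Or.inl hlt
    · exact Or.inr ⟨heq, by simp [heq]⟩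
  init := ⟨h0, by simp [h0]⟩
  last := ⟨h1, by simp [h1]⟩

/-- The time component of a parametric representation is nondecreasing. -/
lemma IsParamRep.monotoneOn {V : Type*} [NormedAddCommGroup V] [NormedSpace ℝ V]
    {f : ℝ → V} {a b : ℝ} {r : ℝ → ℝ} {u : ℝ → V} (h : IsParamRep f a b r u) :
    MonotoneOn r (Set.Icc 0 1) := fun s₁ hs₁ s₂ hs₂ hs => by
  rcases h.mono s₁ hs₁ s₂ hs₂ hs with hlt | ⟨heq, -⟩
  exacts [hlt.le, heq.le]

/-- A pair of uniformly close parametric representations bounds `dM`. -/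
lemma dM_le_of_isParamRep {V : Type*} [NormedAddCommGroup V] [NormedSpace ℝ V]
    {a b c : ℝ} {f₁ f₂ : ℝ → V} {r₁ r₂ : ℝ → ℝ} {u₁ u₂ : ℝ → V}
    (h₁ : IsParamRep f₁ a b r₁ u₁) (h₂ : IsParamRep f₂ a b r₂ u₂)
    (hr : ∀ s ∈ Set.Icc (0:ℝ) 1, |r₁ s - r₂ s| ≤ c)
    (hu : ∀ s ∈ Set.Icc (0:ℝ) 1, ‖u₁ s - u₂ s‖ ≤ c) : dM a b f₁ f₂ ≤ c := by
  have : Nonempty (Set.Icc (0:ℝ) 1) := ⟨⟨0, by simp⟩⟩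
  unfold dM
  refine le_trans (csInf_le ⟨0, ?_⟩ ⟨r₁, u₁, r₂, u₂, h₁, h₂, rfl⟩)
    (max_le (ciSup_le fun s => hr s.1 s.2) (ciSup_le fun s => hu s.1 s.2))
  rintro d ⟨r₁, u₁, r₂, u₂, -, -, rfl⟩
  exact le_max_of_le_left (Real.iSup_nonneg fun s => abs_nonneg _)

/-- A strictly increasing continuous map of `[0,1]` onto `[a,b]` transports any continuous path
on `[0,1]` to a continuous path on `[a,b]`. -/
lemma exists_continuousMap_comp_eq {V : Type*} [TopologicalSpace V]
    {a b : ℝ} {φ : ℝ → ℝ} {u : ℝ → V}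
    (hφ : ContinuousOn φ (Set.Icc 0 1)) (hmono : StrictMonoOn φ (Set.Icc 0 1))
    (h0 : φ 0 = a) (h1 : φ 1 = b) (hu : ContinuousOn u (Set.Icc 0 1)) :
    ∃ g : C(Set.Icc a b, V), ∀ s ∈ Set.Icc (0:ℝ) 1, ∀ h : φ s ∈ Set.Icc a b,
      g ⟨φ s, h⟩ = u s := by
  have hmaps : Set.MapsTo φ (Set.Icc 0 1) (Set.Icc a b) := fun s hs =>
    ⟨h0 ▸ hmono.monotoneOn (by simp) hs hs.1, h1 ▸ hmono.monotoneOn hs (by simp) hs.2⟩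
  have hsurj : Set.SurjOn φ (Set.Icc 0 1) (Set.Icc a b) := by
    have := intermediate_value_Icc zero_le_one hφ
    rwa [h0, h1] at this
  let e : Set.Icc (0:ℝ) 1 ≃ Set.Icc a b := Equiv.ofBijective hmaps.restrict
    ⟨hmaps.restrict_inj.mpr hmono.injOn, hmaps.restrict_surjective_iff.mpr hsurj⟩
  let E : Set.Icc (0:ℝ) 1 ≃ₜ Set.Icc a b := Continuous.homeoOfEquivCompactToT2 (f := e)
    (hφ.mapsToRestrict hmaps)
  refine ⟨⟨fun t => u (E.symm t), hu.domRestrict.comp E.symm.continuous⟩, fun s hs h => ?_⟩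
  have : E.symm ⟨φ s, h⟩ = ⟨s, hs⟩ := E.symm_apply_eq.mpr rfl
  exact congrArg (fun x : Set.Icc (0:ℝ) 1 => u x) this

/-- Along any parametric representation `(r, u)` of `f`, the time component can be perturbed to be
strictly increasing; hence functions continuous on `[0,T]` approximate `f`. -/
lemma IsParamRep.dM_IccExtend_lt {V : Type*} [NormedAddCommGroup V] [NormedSpace ℝ V]
    {T : ℝ} (hT : 0 < T) {f : ℝ → V} {r : ℝ → ℝ} {u : ℝ → V} (h : IsParamRep f 0 T r u)
    {D : Set C(Set.Icc 0 T, V)} (hD : Dense D) {ε : ℝ} (hε : 0 < ε) :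
    ∃ k ∈ D, dM 0 T f (Set.IccExtend hT.le k) < ε := by
  have hr : ContinuousOn r (Set.Icc 0 1) := continuous_fst.comp_continuousOn h.contOn
  have hu : ContinuousOn u (Set.Icc 0 1) := continuous_snd.comp_continuousOn h.contOn
  obtain ⟨η, hη, hη1, hηT⟩ : ∃ η : ℝ, 0 < η ∧ η ≤ 1 ∧ η * T ≤ ε / 2 := by
    refine ⟨min 1 (ε / 2 / T), by positivity, min_le_left _ _, ?_⟩
    rw [← le_div_iff₀ hT]
    exact min_le_right _ _
  let φ : ℝ → ℝ := fun s => (1 - η) * r s + η * (T * s)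
  have hφ : ContinuousOn φ (Set.Icc 0 1) := by fun_prop
  have hφ0 : φ 0 = 0 := by simp [φ, h.init.1]
  have hφ1 : φ 1 = T := by simp only [φ, h.last.1]; ring
  have hφm : StrictMonoOn φ (Set.Icc 0 1) := fun s hs t ht hst => by
    have h1 := mul_le_mul_of_nonneg_left (h.monotoneOn hs ht hst.le) (sub_nonneg.mpr hη1)
    have h2 : η * (T * s) < η * (T * t) := by gcongr
    exact add_lt_add_of_le_of_lt h1 h2
  have hmem : ∀ s ∈ Set.Icc (0:ℝ) 1, φ s ∈ Set.Icc 0 T := fun s hs =>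
    ⟨hφ0 ▸ hφm.monotoneOn (by simp) hs hs.1, hφ1 ▸ hφm.monotoneOn hs (by simp) hs.2⟩
  obtain ⟨g, hg⟩ := exists_continuousMap_comp_eq hφ hφm hφ0 hφ1 hu
  obtain ⟨k, hkD, hk⟩ := hD.exists_dist_lt g (half_pos hε)
  refine ⟨k, hkD, lt_of_le_of_lt ?_ (half_lt_self hε)⟩
  refine dM_le_of_isParamRep h
    (k.continuous.Icc_extend'.isParamRep hφ hφm.monotoneOn hφ0 hφ1) (fun s hs => ?_)
    (fun s hs => ?_)
  · have hrs := (h.mem s hs).1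
    have hTs : 0 ≤ T * s ∧ T * s ≤ T := ⟨mul_nonneg hT.le hs.1, mul_le_of_le_one_right hT.le hs.2⟩
    have : r s - φ s = η * (r s - T * s) := by simp only [φ]; ring
    rw [this, abs_mul, abs_of_pos hη]
    refine le_trans ?_ hηT
    gcongr
    exact abs_sub_le_of_nonneg_of_le hrs.1 hrs.2 hTs.1 hTs.2
  · rw [Function.comp_apply, Set.IccExtend_of_mem hT.le k (hmem s hs), ← hg s hs (hmem s hs),
      ← dist_eq_norm]
    exact (ContinuousMap.dist_apply_le_dist _).trans hk.le

/-- for a separable real Banach space `V`, the metric space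
`(D([0,T];V), d_M)` is separable: there is a countable set of càdlàg functions which is
dense with respect to `d_M`. -/
theorem dM_separable {V : Type*} [NormedAddCommGroup V] [NormedSpace ℝ V]
    [CompleteSpace V] [TopologicalSpace.SeparableSpace V]
    (T : ℝ) (hT : 0 < T) :
    ∃ S : Set (ℝ → V), S.Countable ∧ (∀ g ∈ S, IsCadlagOn g 0 T) ∧
      ∀ f : ℝ → V, IsCadlagOn f 0 T → ∀ ε > (0:ℝ), ∃ g ∈ S, dM 0 T f g < ε := by
  have : SecondCountableTopology V := UniformSpace.secondCountable_of_separable V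
  obtain ⟨D, hDc, hD⟩ := TopologicalSpace.exists_countable_dense C(Set.Icc 0 T, V)
  refine ⟨(fun k : C(Set.Icc 0 T, V) => Set.IccExtend hT.le k) '' D, hDc.image _, ?_, ?_⟩
  · rintro _ ⟨k, -, rfl⟩
    have hk : Continuous (Set.IccExtend hT.le k) := k.continuous.Icc_extend'
    exact ⟨fun t _ => hk.continuousAt.mono_left nhdsWithin_le_nhds,
      fun t _ => ⟨_, hk.continuousAt.mono_left nhdsWithin_le_nhds⟩⟩
  · intro f _ ε hε
    by_cases h : ∃ r u, IsParamRep f 0 T r u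
    · obtain ⟨r, u, h⟩ := h
      obtain ⟨k, hk, hlt⟩ := h.dM_IccExtend_lt hT hD hε
      exact ⟨_, ⟨k, hk, rfl⟩, hlt⟩
    · obtain ⟨k, hk⟩ := hD.nonempty
      refine ⟨_, ⟨k, hk, rfl⟩, ?_⟩
      unfold dM
      convert hε
      rw [Set.eq_empty_of_forall_notMem (s := {d : ℝ | _}), Real.sInf_empty]
      rintro d ⟨r, u, -, -, hf, -⟩
      exact h ⟨r, u, hf⟩
end

section
/- Let V be an infinite-dimensional separable real Hilbert space with orthonormal basis (e_n)_{n ∈ ℕ}, and define the constant functions f_n : [0,T] → V, f_n(t) := e_n. Then: (a) for every v ∈ V, sup_{t ∈ [0,T]} |⟨f_n(t), v⟩| = |⟨e_n, v⟩| → 0 as n → ∞, so the real-valued functions ⟨f_n(·), v⟩ converge to the zero function in the strong M₁ metric d_M on D([0,T];ℝ); (b) d_M(f_n, 0) ≥ 1 for every n, where 0 denotes the zero function in D([0,T];V), so (f_n) does not converge to 0 in the strong M₁ metric on D([0,T];V). Hence weak M₁ convergence does not imply strong M₁ convergence in infinite dimensions. -/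
section

open Filter Set Topology

theorem leftLimIn_const {V : Type*} [NormedAddCommGroup V] (c : V) (a t : ℝ) :
    leftLimIn (fun _ => c) a t = c := by
  unfold leftLimIn
  split_ifs
  · exact leftLim_eq_of_tendsto tendsto_const_nhds
  · rfl

theorem mem_extGraph_const {V : Type*} [NormedAddCommGroup V] [NormedSpace ℝ V]
    {c : V} {a b : ℝ} {p : ℝ × V} :
    p ∈ extGraph (fun _ => c) a b ↔ p.1 ∈ Icc a b ∧ p.2 = c := by
  simp only [extGraph, mem_ofPred_eq, leftLimIn_const, ← add_smul, add_sub_cancel, one_smul]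
  exact and_congr_right fun _ => ⟨fun ⟨_, _, h⟩ => h, fun h => ⟨0, by simp, h⟩⟩

theorem isParamRep_const {V : Type*} [NormedAddCommGroup V] [NormedSpace ℝ V]
    (c : V) {a b : ℝ} (hab : a < b) :
    IsParamRep (fun _ => c) a b (fun s => a + s * (b - a)) (fun _ => c) where
  contOn := by fun_prop
  mem s hs := mem_extGraph_const.2
    ⟨⟨by nlinarith [hs.1], by nlinarith [hs.2]⟩, rfl⟩
  surj p hp := by
    obtain ⟨⟨hap, hpb⟩, hc⟩ := mem_extGraph_const.1 hp
    have hba : 0 < b - a := sub_pos.2 hab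
    refine ⟨(p.1 - a) / (b - a), ⟨div_nonneg (by linarith) hba.le, ?_⟩, ?_⟩
    · rw [div_le_one hba]
      linarith
    · ext
      · simp [div_mul_cancel₀ _ hba.ne']
      · exact hc.symm
  mono s₁ _ s₂ _ h := by
    rcases h.lt_or_eq with h | rfl
    · exact Or.inl (by simpa using mul_lt_mul_of_pos_right h (sub_pos.2 hab))
    · exact Or.inr ⟨rfl, le_rfl⟩
  init := by simp
  last := by simp

/-- The strong `M₁` distance between two constant functions is the distance of their values. -/
theorem dM_const {V : Type*} [NormedAddCommGroup V] [NormedSpace ℝ V]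
    (c d : V) {a b : ℝ} (hab : a < b) :
    dM a b (fun _ => c) (fun _ => d) = ‖c - d‖ := by
  have : Nonempty (Icc (0 : ℝ) 1) := ⟨⟨0, by simp⟩⟩
  refine IsLeast.csInf_eq ⟨⟨_, _, _, _, isParamRep_const c hab, isParamRep_const d hab, ?_⟩, ?_⟩
  · simp
  · rintro _ ⟨r₁, u₁, r₂, u₂, h₁, h₂, rfl⟩
    refine le_max_of_le_right (le_of_eq ?_)
    have key : ∀ s : Icc (0 : ℝ) 1, ‖u₁ s.1 - u₂ s.1‖ = ‖c - d‖ := fun s => by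
      have hc : u₁ s.1 = c := (mem_extGraph_const.1 (h₁.mem s.1 s.2)).2
      have hd : u₂ s.1 = d := (mem_extGraph_const.1 (h₂.mem s.1 s.2)).2
      rw [hc, hd]
    simp only [key, ciSup_const]

/-- An orthonormal sequence converges weakly to zero. -/
theorem Orthonormal.tendsto_inner_zero {V : Type*} [NormedAddCommGroup V] [InnerProductSpace ℝ V]
    {e : ℕ → V} (he : Orthonormal ℝ e) (v : V) :
    Tendsto (fun n => |inner ℝ (e n) v|) atTop (𝓝 0) := by
  have h := (he.inner_products_summable v).tendsto_atTop_zero.sqrt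
  simpa [Real.sqrt_sq_eq_abs] using h

end

/-- let `V` be an infinite-dimensional separable real Hilbert space with
orthonormal basis `(eₙ)` and `fₙ(t) := eₙ` the constant functions on `[0,T]`. Then
(a) for every `v ∈ V`, `sup_t |⟨fₙ(t), v⟩| = |⟨eₙ, v⟩| → 0`, and the real functions
`⟨fₙ(·), v⟩` converge to `0` in `d_M`; (b) `d_M(fₙ, 0) ≥ 1` for every `n`, so `(fₙ)` does not
converge to `0` in the strong `M₁` metric. -/
theorem weak_M1_not_strong_M1 {V : Type*} [NormedAddCommGroup V] [InnerProductSpace ℝ V]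
    [CompleteSpace V] [TopologicalSpace.SeparableSpace V]
    (T : ℝ) (hT : 0 < T) (e : ℕ → V) (he : Orthonormal ℝ e)
    (hdense : Dense (Submodule.span ℝ (Set.range e) : Set V)) :
    (∀ v : V, Filter.Tendsto
        (fun n => ⨆ t : Set.Icc (0:ℝ) T, |(@inner ℝ V _ (e n) v)|)
        Filter.atTop (nhds 0)) ∧
    (∀ v : V, Filter.Tendsto
        (fun n => dM 0 T (fun _ : ℝ => (@inner ℝ V _ (e n) v)) (fun _ : ℝ => (0:ℝ)))
        Filter.atTop (nhds 0)) ∧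
    (∀ n : ℕ, (1:ℝ) ≤ dM 0 T (fun _ : ℝ => e n) (fun _ : ℝ => (0:V))) ∧
    ¬ Filter.Tendsto (fun n => dM 0 T (fun _ : ℝ => e n) (fun _ : ℝ => (0:V)))
        Filter.atTop (nhds 0) := by
  have : Nonempty (Set.Icc (0 : ℝ) T) := ⟨⟨0, by simp [hT.le]⟩⟩
  have hdM : ∀ n, dM 0 T (fun _ : ℝ => e n) (fun _ : ℝ => (0 : V)) = 1 := fun n => by
    rw [dM_const _ _ hT, sub_zero, he.1 n]
  refine ⟨fun v => ?_, fun v => ?_, fun n => (hdM n).ge, fun h => ?_⟩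
  · simpa only [ciSup_const] using he.tendsto_inner_zero v
  · simpa only [dM_const _ _ hT, sub_zero, Real.norm_eq_abs] using he.tendsto_inner_zero v
  · simp only [hdM] at h
    exact one_ne_zero (tendsto_nhds_unique tendsto_const_nhds h)
end

section
/- Let V be a separable real Banach space and T > 0. The Borel σ-algebra of the metric space (D([0,T];V), d_M) coincides with the σ-algebra on D([0,T];V) generated by the coordinate (evaluation) mappings π_{t₁,…,t_n} : D([0,T];V) → Vⁿ, π_{t₁,…,t_n}(f) = (f(t₁), …, f(t_n)), for t₁, …, t_n ∈ [0,T] and n ∈ ℕ. -/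
section TimeChange

open Filter Set Topology Function

variable {V : Type*} [NormedAddCommGroup V]

/-- A function on the whole line that is right-continuous and has left limits. -/
structure IsCadlag (g : ℝ → V) : Prop where
  right : ∀ t, Tendsto g (𝓝[>] t) (𝓝 (g t))
  left : ∀ t, Tendsto g (𝓝[<] t) (𝓝 (leftLim g t))

/-- A time scale `σ` that runs at least at unit speed and jumps whenever `g` jumps. -/
structure IsClock (σ : ℝ → ℝ) (g : ℝ → V) : Prop where
  expand : ∀ s t, s ≤ t → t - s ≤ σ t - σ s
  jump : ∀ t, leftLim σ t = rightLim σ t → leftLim g t = g t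

/-- The generalized inverse of a clock. -/
noncomputable def clockInv (σ : ℝ → ℝ) (x : ℝ) : ℝ := sSup {t | σ t ≤ x}

namespace IsClock

variable {σ : ℝ → ℝ} {g : ℝ → V}

lemma strictMono (h : IsClock σ g) : StrictMono σ := fun s t hst => by
  have := h.expand s t hst.le
  linarith

lemma nonempty (h : IsClock σ g) (x : ℝ) : {t | σ t ≤ x}.Nonempty := by
  refine ⟨min 0 (x - σ 0), ?_⟩
  have h1 := h.expand (min 0 (x - σ 0)) 0 (min_le_left _ _)
  have h2 := min_le_right 0 (x - σ 0)
  simp only [mem_ofPred_eq]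
  linarith

lemma bddAbove (h : IsClock σ g) (x : ℝ) : BddAbove {t | σ t ≤ x} := by
  refine ⟨max 0 (x - σ 0), fun t ht => ?_⟩
  by_contra! hlt
  have h1 := h.expand 0 t ((le_max_left _ _).trans hlt.le)
  have h2 := le_max_right 0 (x - σ 0)
  simp only [mem_ofPred_eq] at ht
  linarith

lemma le_of_lt_inv (h : IsClock σ g) {t x : ℝ} (ht : t < clockInv σ x) : σ t ≤ x := by
  obtain ⟨s, hs, hts⟩ := exists_lt_of_lt_csSup (h.nonempty x) ht
  exact (h.strictMono.monotone hts.le).trans hs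

lemma lt_of_inv_lt (h : IsClock σ g) {t x : ℝ} (ht : clockInv σ x < t) : x < σ t := by
  by_contra! hx
  exact absurd (le_csSup (h.bddAbove x) hx) (not_le.2 ht)

lemma leftLim_inv_le (h : IsClock σ g) (x : ℝ) : leftLim σ (clockInv σ x) ≤ x :=
  le_of_tendsto (h.strictMono.monotone.tendsto_leftLim _)
    (eventually_mem_nhdsWithin.mono fun _ ht => h.le_of_lt_inv ht)

lemma le_rightLim_inv (h : IsClock σ g) (x : ℝ) : x ≤ rightLim σ (clockInv σ x) :=
  ge_of_tendsto (h.strictMono.monotone.tendsto_rightLim _)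
    (eventually_mem_nhdsWithin.mono fun _ ht => (h.lt_of_inv_lt ht).le)

lemma inv_eq (h : IsClock σ g) {t x : ℝ} (h1 : leftLim σ t ≤ x) (h2 : x ≤ rightLim σ t) :
    clockInv σ x = t := by
  have hm := h.strictMono.monotone
  apply le_antisymm
  · by_contra! hlt
    obtain ⟨s, hs, hs'⟩ := exists_between hlt
    obtain ⟨s₁, hs₁, hs₁'⟩ := exists_between hs
    have := h.le_of_lt_inv hs'
    have := hm.rightLim_le hs₁
    have := h.strictMono hs₁'
    linarith
  · by_contra! hlt
    obtain ⟨s, hs, hs'⟩ := exists_between hlt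
    have := h.lt_of_inv_lt hs
    have := hm.le_leftLim hs'
    linarith

lemma inv_mono (h : IsClock σ g) : Monotone (clockInv σ) := fun _ y hxy =>
  csSup_le_csSup (h.bddAbove y) (h.nonempty _) fun _ ht => le_trans ht hxy

lemma continuous_inv (h : IsClock σ g) : Continuous (clockInv σ) :=
  h.inv_mono.continuous_of_surjective fun t => ⟨σ t,
    h.inv_eq (h.strictMono.monotone.leftLim_le le_rfl) (h.strictMono.monotone.le_rightLim le_rfl)⟩

lemma coeff_mem (h : IsClock σ g) (x : ℝ) :
    (x - leftLim σ (clockInv σ x)) / (rightLim σ (clockInv σ x) - leftLim σ (clockInv σ x)) ∈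
      Icc (0 : ℝ) 1 := by
  have h1 := h.leftLim_inv_le x
  have h2 := h.le_rightLim_inv x
  exact ⟨div_nonneg (by linarith) (by linarith), div_le_one_of_le₀ (by linarith) (by linarith)⟩

end IsClock

/-- Left limits inherit membership in a closed set that holds on an open interval. -/
lemma IsCadlag.leftLim_mem {g : ℝ → V} (hg : IsCadlag g) {K : Set V} (hK : IsClosed K)
    {a b : ℝ} (h : ∀ t ∈ Ioo a b, g t ∈ K) {t : ℝ} (ht : t ∈ Ioo a b) : leftLim g t ∈ K := by
  refine hK.mem_of_tendsto (hg.left t) ?_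
  filter_upwards [Ioo_mem_nhdsLT ht.1] with s hs
  exact h s ⟨hs.1, hs.2.trans ht.2⟩

variable [NormedSpace ℝ V]

/-- The path `g` run along the clock `σ`, with jumps filled in linearly. -/
noncomputable def filledPath (σ : ℝ → ℝ) (g : ℝ → V) (x : ℝ) : V :=
  leftLim g (clockInv σ x) +
    ((x - leftLim σ (clockInv σ x)) / (rightLim σ (clockInv σ x) - leftLim σ (clockInv σ x))) •
      (g (clockInv σ x) - leftLim g (clockInv σ x))

namespace IsClock

variable {σ : ℝ → ℝ} {g : ℝ → V}

/-- On the part of the clock spent at `t`, the filled path runs linearly from the left limit. -/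
lemma filledPath_of_mem (h : IsClock σ g) {t x : ℝ} (h1 : leftLim σ t ≤ x)
    (h2 : x ≤ rightLim σ t) : filledPath σ g x = leftLim g t +
      ((x - leftLim σ t) / (rightLim σ t - leftLim σ t)) • (g t - leftLim g t) := by
  rw [filledPath, h.inv_eq h1 h2]

lemma filledPath_leftLim (h : IsClock σ g) (t : ℝ) :
    filledPath σ g (leftLim σ t) = leftLim g t := by
  rw [h.filledPath_of_mem le_rfl (h.strictMono.monotone.leftLim_le_rightLim le_rfl)]
  simp

lemma filledPath_rightLim (h : IsClock σ g) (t : ℝ) : filledPath σ g (rightLim σ t) = g t := by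
  rw [h.filledPath_of_mem (h.strictMono.monotone.leftLim_le_rightLim le_rfl) le_rfl]
  rcases eq_or_ne (leftLim σ t) (rightLim σ t) with he | he
  · simp [h.jump t he]
  · rw [div_self (sub_ne_zero.2 he.symm)]
    simp

lemma filledPath_mem_of_convex (h : IsClock σ g) {K : Set V} (hK : Convex ℝ K) {x : ℝ}
    (h1 : leftLim g (clockInv σ x) ∈ K) (h2 : g (clockInv σ x) ∈ K) : filledPath σ g x ∈ K :=
  hK.add_smul_sub_mem h1 h2 (h.coeff_mem x)

end IsClock

lemma IsClock.continuous_filledPath {σ : ℝ → ℝ} {g : ℝ → V} (h : IsClock σ g)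
    (hg : IsCadlag g) : Continuous (filledPath σ g) := by
  have hm := h.strictMono.monotone
  have key : ∀ (a b : ℝ) (K : Set V), Convex ℝ K → IsClosed K → (∀ t ∈ Ioo a b, g t ∈ K) →
      ∀ y, clockInv σ y ∈ Ioo a b → filledPath σ g y ∈ K := fun a b K hc hK hab y hy =>
    h.filledPath_mem_of_convex hc (hg.leftLim_mem hK hab hy) (hab _ hy)
  have affine : ∀ t, Continuous fun y : ℝ => leftLim g t +
      ((y - leftLim σ t) / (rightLim σ t - leftLim σ t)) • (g t - leftLim g t) := fun t => by
    fun_prop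
  rw [continuous_iff_continuousAt]
  intro x
  obtain ⟨t, ht⟩ : ∃ t, clockInv σ x = t := ⟨_, rfl⟩
  have h1 : leftLim σ t ≤ x := ht ▸ h.leftLim_inv_le x
  have h2 : x ≤ rightLim σ t := ht ▸ h.le_rightLim_inv x
  have hc := h.continuous_inv.continuousAt (x := x)
  rw [ContinuousAt, ht] at hc
  rw [continuousAt_iff_continuous_left'_right']
  constructor
  · rcases h1.eq_or_lt with he | hlt
    · rw [ContinuousWithinAt, ← he, h.filledPath_leftLim, he,
        Metric.nhds_basis_closedBall.tendsto_right_iff]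
      intro ε hε
      have := (hg.left t).eventually (Metric.closedBall_mem_nhds _ hε)
      obtain ⟨a, hat, ha⟩ := (mem_nhdsLT_iff_exists_Ioo_subset).1 this
      filter_upwards [self_mem_nhdsWithin,
        nhdsWithin_le_nhds (hc.eventually (lt_mem_nhds hat))] with y hy hya
      refine key a t _ (convex_closedBall _ _) Metric.isClosed_closedBall (fun s hs => ha hs) y
        ⟨hya, ?_⟩
      refine lt_of_le_of_ne (ht ▸ h.inv_mono hy.le) fun hyt => ?_
      have := h.leftLim_inv_le y
      rw [hyt, he] at this
      exact absurd this (not_le.2 hy)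
    · refine ((affine t).continuousWithinAt).congr_of_eventuallyEq ?_
        (h.filledPath_of_mem h1 h2)
      filter_upwards [Ioo_mem_nhdsLT hlt] with y hy
      exact h.filledPath_of_mem hy.1.le (hy.2.le.trans h2)
  · rcases h2.eq_or_lt with he | hlt
    · rw [ContinuousWithinAt, he, h.filledPath_rightLim, ← he,
        Metric.nhds_basis_closedBall.tendsto_right_iff]
      intro ε hε
      have := (hg.right t).eventually (Metric.closedBall_mem_nhds _ hε)
      obtain ⟨b, hbt, hb⟩ := (mem_nhdsGT_iff_exists_Ioo_subset).1 this
      filter_upwards [self_mem_nhdsWithin,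
        nhdsWithin_le_nhds (hc.eventually (gt_mem_nhds hbt))] with y hy hyb
      refine key t b _ (convex_closedBall _ _) Metric.isClosed_closedBall (fun s hs => hb hs) y
        ⟨?_, hyb⟩
      refine lt_of_le_of_ne (ht ▸ h.inv_mono (le_of_lt hy)) fun hyt => ?_
      have := h.le_rightLim_inv y
      rw [← hyt, ← he] at this
      exact absurd this (not_le.2 hy)
    · refine ((affine t).continuousWithinAt).congr_of_eventuallyEq ?_
        (h.filledPath_of_mem h1 h2)
      filter_upwards [Ioo_mem_nhdsGT hlt] with y hy
      exact h.filledPath_of_mem (h1.trans hy.1.le) hy.2.le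

end TimeChange

section ClampExt

open Filter Set Topology Function

variable {V : Type*}

/-- The extension of a function on `[0, T]` to the line that is constant outside `[0, T]`. -/
def clampExt (T : ℝ) (f : ℝ → V) (t : ℝ) : V := f (max 0 (min t T))

lemma clampExt_of_mem {T : ℝ} (f : ℝ → V) {t : ℝ} (ht : t ∈ Icc 0 T) : clampExt T f t = f t := by
  rw [clampExt, min_eq_left ht.2, max_eq_right ht.1]

lemma clampExt_of_nonpos {T : ℝ} (hT : 0 < T) (f : ℝ → V) {t : ℝ} (ht : t ≤ 0) :
    clampExt T f t = f 0 := by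
  rw [clampExt, min_eq_left (ht.trans hT.le), max_eq_left ht]

lemma clampExt_of_ge {T : ℝ} (hT : 0 < T) (f : ℝ → V) {t : ℝ} (ht : T ≤ t) :
    clampExt T f t = f T := by
  rw [clampExt, min_eq_right ht, max_eq_right hT.le]

variable [NormedAddCommGroup V]

lemma tendsto_clampExt_left {T : ℝ} (hT : 0 < T) {f : ℝ → V} (hf : IsCadlagOn f 0 T) (t : ℝ) :
    ∃ l, Tendsto (clampExt T f) (𝓝[<] t) (𝓝 l) := by
  rcases le_or_gt t 0 with h0 | h0
  · refine ⟨f 0, tendsto_const_nhds.congr' ?_⟩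
    filter_upwards [self_mem_nhdsWithin] with s hs
    exact (clampExt_of_nonpos hT f (le_of_lt (lt_of_lt_of_le hs h0))).symm
  rcases lt_or_ge T t with hTt | hTt
  · refine ⟨f T, tendsto_const_nhds.congr' ?_⟩
    filter_upwards [Ioo_mem_nhdsLT hTt] with s hs
    exact (clampExt_of_ge hT f hs.1.le).symm
  · obtain ⟨l, hl⟩ := hf.2 t ⟨h0, hTt⟩
    refine ⟨l, ?_⟩
    rw [nhdsWithin_Ico_eq_nhdsLT h0] at hl
    refine hl.congr' ?_
    filter_upwards [Ioo_mem_nhdsLT h0] with s hs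
    exact (clampExt_of_mem f ⟨hs.1.le, hs.2.le.trans hTt⟩).symm

lemma isCadlag_clampExt {T : ℝ} (hT : 0 < T) {f : ℝ → V} (hf : IsCadlagOn f 0 T) :
    IsCadlag (clampExt T f) where
  left t := tendsto_leftLim_of_tendsto (tendsto_clampExt_left hT hf t)
  right t := by
    rcases lt_or_ge t 0 with h0 | h0
    · rw [clampExt_of_nonpos hT f h0.le]
      refine tendsto_const_nhds.congr' ?_
      filter_upwards [Ioo_mem_nhdsGT h0] with s hs
      exact (clampExt_of_nonpos hT f hs.2.le).symm
    rcases le_or_gt T t with hTt | hTt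
    · rw [clampExt_of_ge hT f hTt]
      refine tendsto_const_nhds.congr' ?_
      filter_upwards [self_mem_nhdsWithin] with s hs
      exact (clampExt_of_ge hT f (hTt.trans (le_of_lt hs))).symm
    · have hl := hf.1 t ⟨h0, hTt⟩
      rw [nhdsWithin_Ioc_eq_nhdsGT hTt] at hl
      rw [clampExt_of_mem f ⟨h0, hTt.le⟩]
      refine hl.congr' ?_
      filter_upwards [Ioo_mem_nhdsGT hTt] with s hs
      exact (clampExt_of_mem f ⟨h0.trans hs.1.le, hs.2.le⟩).symm

lemma leftLimIn_eq_leftLim_clampExt {T : ℝ} (hT : 0 < T) {f : ℝ → V} (hf : IsCadlagOn f 0 T)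
    {t : ℝ} (ht : t ∈ Icc 0 T) : leftLimIn f 0 t = leftLim (clampExt T f) t := by
  have hl := (isCadlag_clampExt hT hf).left t
  symm
  rw [leftLimIn]
  split_ifs with h0
  · refine (leftLim_eq_of_tendsto (hl.congr' ?_)).symm
    filter_upwards [Ioo_mem_nhdsLT h0] with s hs
    exact clampExt_of_mem f ⟨hs.1.le, hs.2.le.trans ht.2⟩
  · refine leftLim_eq_of_tendsto (tendsto_const_nhds.congr' ?_)
    filter_upwards [self_mem_nhdsWithin] with s hs
    exact (clampExt_of_nonpos hT f (le_of_lt (lt_of_lt_of_le hs (not_lt.1 h0)))).symm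

variable [NormedSpace ℝ V]

/-- The affine map from `[0, 1]` onto the range of clock values over `[0, T]`. -/
noncomputable def clockScale (σ : ℝ → ℝ) (T s : ℝ) : ℝ :=
  leftLim σ 0 + s * (rightLim σ T - leftLim σ 0)

/-- Reading a path with its jumps filled in off a clock gives a parametric representation. -/
lemma IsClock.isParamRep {T : ℝ} (hT : 0 < T) {f : ℝ → V} (hf : IsCadlagOn f 0 T) {σ : ℝ → ℝ}
    (h : IsClock σ (clampExt T f)) :
    IsParamRep f 0 T (fun s => clockInv σ (clockScale σ T s))
      (fun s => filledPath σ (clampExt T f) (clockScale σ T s)) := by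
  have hg := isCadlag_clampExt hT hf
  have hm := h.strictMono.monotone
  have hlr : leftLim σ 0 < rightLim σ T :=
    (hm.leftLim_le le_rfl).trans_lt ((h.strictMono hT).trans_le (hm.le_rightLim le_rfl))
  have hscale : Monotone (clockScale σ T) := fun a b hab => by
    unfold clockScale
    nlinarith
  have hinv0 : clockInv σ (leftLim σ 0) = 0 := h.inv_eq le_rfl (hm.leftLim_le_rightLim le_rfl)
  have hinvT : clockInv σ (rightLim σ T) = T := h.inv_eq (hm.leftLim_le_rightLim le_rfl) le_rfl
  have hs0 : clockScale σ T 0 = leftLim σ 0 := by simp [clockScale]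
  have hs1 : clockScale σ T 1 = rightLim σ T := by simp [clockScale]
  have hmem : ∀ s ∈ Icc (0 : ℝ) 1, clockInv σ (clockScale σ T s) ∈ Icc 0 T := fun s hs => by
    constructor
    · rw [← hinv0, ← hs0]
      exact h.inv_mono (hscale hs.1)
    · conv_rhs => rw [← hinvT, ← hs1]
      exact h.inv_mono (hscale hs.2)
  refine ⟨?_, ?_, ?_, ?_, ?_, ?_⟩
  · have hc : Continuous (clockScale σ T) := by
      unfold clockScale
      fun_prop
    exact ((h.continuous_inv.comp hc).prodMk ((h.continuous_filledPath hg).comp hc)).continuousOn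
  · intro s hs
    refine ⟨hmem s hs, _, ⟨sub_nonneg.2 (h.coeff_mem (clockScale σ T s)).2,
      sub_le_self 1 (h.coeff_mem (clockScale σ T s)).1⟩, ?_⟩
    simp only
    rw [leftLimIn_eq_leftLim_clampExt hT hf (hmem s hs), ← clampExt_of_mem f (hmem s hs),
      filledPath]
    module
  · rintro ⟨t, v⟩ ⟨ht, α, hα, hv⟩
    simp only at ht hv
    rw [leftLimIn_eq_leftLim_clampExt hT hf ht, ← clampExt_of_mem f ht] at hv
    have hle := hm.leftLim_le_rightLim (le_refl t)
    have hx1 : leftLim σ t ≤ α * leftLim σ t + (1 - α) * rightLim σ t := by nlinarith [hα.1, hα.2]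
    have hx2 : α * leftLim σ t + (1 - α) * rightLim σ t ≤ rightLim σ t := by
      nlinarith [hα.1, hα.2]
    have hy1 := (hm.leftLim ht.1).trans hx1
    have hy2 := hx2.trans (hm.rightLim ht.2)
    have hpos := sub_pos.2 hlr
    refine ⟨(α * leftLim σ t + (1 - α) * rightLim σ t - leftLim σ 0) /
      (rightLim σ T - leftLim σ 0), ⟨div_nonneg (by linarith) hpos.le,
      div_le_one_of_le₀ (by linarith) hpos.le⟩, ?_⟩
    have hsc : clockScale σ T ((α * leftLim σ t + (1 - α) * rightLim σ t - leftLim σ 0) /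
      (rightLim σ T - leftLim σ 0)) = α * leftLim σ t + (1 - α) * rightLim σ t := by
      rw [clockScale, div_mul_cancel₀ _ hpos.ne']
      ring
    simp only [hsc, h.inv_eq hx1 hx2, Prod.mk.injEq, true_and, h.filledPath_of_mem hx1 hx2, hv]
    rcases eq_or_ne (leftLim σ t) (rightLim σ t) with he | he
    · rw [h.jump t he]
      module
    · have : (α * leftLim σ t + (1 - α) * rightLim σ t - leftLim σ t) /
          (rightLim σ t - leftLim σ t) = 1 - α := by
        rw [div_eq_iff (sub_ne_zero.2 he.symm)]
        ring
      rw [this]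
      module
  · intro s₁ hs₁ s₂ hs₂ hs
    have hx := hscale hs
    rcases (h.inv_mono hx).lt_or_eq with hlt | heq
    · exact Or.inl hlt
    · refine Or.inr ⟨heq, ?_⟩
      simp only
      rw [leftLimIn_eq_leftLim_clampExt hT hf (hmem s₁ hs₁)]
      have hle := hm.leftLim_le_rightLim (le_refl (clockInv σ (clockScale σ T s₂)))
      have h0 := (h.coeff_mem (clockScale σ T s₁)).1
      simp only [filledPath]
      rw [heq] at h0 ⊢
      rw [sub_add_cancel_left, sub_add_cancel_left, norm_neg, norm_neg, norm_smul, norm_smul,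
        Real.norm_of_nonneg h0, Real.norm_of_nonneg (h.coeff_mem (clockScale σ T s₂)).1]
      gcongr
  · refine ⟨by simp only [hs0, hinv0], ?_⟩
    simp only [hs0, h.filledPath_leftLim]
    rw [← leftLimIn_eq_leftLim_clampExt hT hf ⟨le_rfl, hT.le⟩, leftLimIn, if_neg (lt_irrefl _)]
  · refine ⟨by simp only [hs1, hinvT], ?_⟩
    simp only [hs1, h.filledPath_rightLim]
    exact clampExt_of_mem f ⟨hT.le, le_rfl⟩

end ClampExt

section HittingClock

open Filter Set Topology Function TopologicalSpace

variable {V : Type*} [NormedAddCommGroup V] [SeparableSpace V]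

/-- For the `k`-th triple `(a, c, ρ)` of a dense sequence, `g` has left the closed ball of centre
`c` and radius `ρ` at a rational time in `[a, t]`. -/
def HasExited (g : ℝ → V) (k : ℕ) (t : ℝ) : Prop :=
  ∃ q : ℚ, (denseSeq (ℝ × V × ℝ) k).1 ≤ q ∧ (q : ℝ) ≤ t ∧
    (denseSeq (ℝ × V × ℝ) k).2.2 < ‖g q - (denseSeq (ℝ × V × ℝ) k).2.1‖

open Classical in
/-- Real time, with an additional jump at each exit time of `g` from a ball. -/
noncomputable def exitClock (g : ℝ → V) (t : ℝ) : ℝ :=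
  t + ∑' k, if HasExited g k t then (1 / 2 : ℝ) ^ k else 0

lemma HasExited.mono {g : ℝ → V} {k : ℕ} {s t : ℝ} (hst : s ≤ t) (h : HasExited g k s) :
    HasExited g k t := by
  obtain ⟨q, h1, h2, h3⟩ := h
  exact ⟨q, h1, h2.trans hst, h3⟩

open Classical in
lemma summable_exitClock (g : ℝ → V) (t : ℝ) :
    Summable fun k => if HasExited g k t then (1 / 2 : ℝ) ^ k else 0 := by
  refine Summable.of_nonneg_of_le (fun k => ?_) (fun k => ?_) summable_geometric_two
  · split_ifs <;> positivity
  · split_ifs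
    · exact le_rfl
    · positivity

open Classical in
lemma exitClock_sub (g : ℝ → V) (s t : ℝ) : exitClock g t - exitClock g s = t - s +
    ∑' k, ((if HasExited g k t then (1 / 2 : ℝ) ^ k else 0) -
      (if HasExited g k s then (1 / 2 : ℝ) ^ k else 0)) := by
  rw [(summable_exitClock g t).tsum_sub (summable_exitClock g s), exitClock, exitClock]
  ring

open Classical in
lemma exitClock_term_nonneg (g : ℝ → V) {s t : ℝ} (hst : s ≤ t) (k : ℕ) :
    0 ≤ (if HasExited g k t then (1 / 2 : ℝ) ^ k else 0) -
      (if HasExited g k s then (1 / 2 : ℝ) ^ k else 0) := by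
  by_cases hs : HasExited g k s
  · simp [hs, hs.mono hst]
  · rw [if_neg hs, sub_zero]
    split_ifs <;> positivity

lemma exitClock_expand (g : ℝ → V) {s t : ℝ} (hst : s ≤ t) :
    t - s ≤ exitClock g t - exitClock g s := by
  rw [exitClock_sub]
  exact le_add_of_nonneg_right (tsum_nonneg (exitClock_term_nonneg g hst))

lemma exitClock_jump (g : ℝ → V) {s t : ℝ} (hst : s ≤ t) {k : ℕ} (hs : ¬ HasExited g k s)
    (ht : HasExited g k t) : (1 / 2 : ℝ) ^ k ≤ exitClock g t - exitClock g s := by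
  have hsum := ((summable_exitClock g t).sub (summable_exitClock g s)).le_tsum k
    fun j _ => exitClock_term_nonneg g hst j
  rw [if_pos ht, if_neg hs, sub_zero] at hsum
  rw [exitClock_sub]
  linarith

lemma isClock_exitClock {g : ℝ → V} (hg : IsCadlag g) : IsClock (exitClock g) g where
  expand s t hst := exitClock_expand g hst
  jump t hlr := by
    by_contra hne
    have hm : Monotone (exitClock g) := fun s t hst => by
      have := exitClock_expand g hst
      linarith
    have hD : 0 < ‖g t - leftLim g t‖ := norm_pos_iff.2 (sub_ne_zero.2 (Ne.symm hne))
    set D := ‖g t - leftLim g t‖ with hDdef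
    have hleft := (hg.left t).eventually (Metric.ball_mem_nhds _ (by positivity : 0 < D / 4))
    obtain ⟨a, hat, ha⟩ := (mem_nhdsLT_iff_exists_Ioo_subset).1 hleft
    obtain ⟨k, hk⟩ := (denseRange_denseSeq (ℝ × V × ℝ)).exists_mem_open
      (isOpen_Ioo.prod (Metric.isOpen_ball.prod isOpen_Ioo) :
        IsOpen (Ioo a t ×ˢ Metric.ball (leftLim g t) (D / 4) ×ˢ Ioo (D / 2) (3 * D / 4)))
      ⟨((a + t) / 2, leftLim g t, 5 * D / 8), by
        have : a < t := hat
        refine ⟨⟨?_, ?_⟩, Metric.mem_ball_self (by positivity), ⟨?_, ?_⟩⟩ <;>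
          simp only <;> linarith⟩
    obtain ⟨⟨hk1, hk2⟩, hk3, hk4, hk5⟩ := hk
    rw [Metric.mem_ball, dist_eq_norm] at hk3
    have hbefore : ∀ s < t, ¬ HasExited g k s := by
      rintro s hs ⟨q, hq1, hq2, hq3⟩
      have hq : (q : ℝ) ∈ Ioo a t := ⟨hk1.trans_le hq1, hq2.trans_lt hs⟩
      have h1 : ‖g q - leftLim g t‖ < D / 4 := mem_ball_iff_norm.1 (ha hq)
      have h2 := norm_sub_le_norm_sub_add_norm_sub (g q) (leftLim g t)
        (denseSeq (ℝ × V × ℝ) k).2.1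
      rw [norm_sub_rev (leftLim g t)] at h2
      linarith
    have hlt : (denseSeq (ℝ × V × ℝ) k).2.2 < ‖g t - (denseSeq (ℝ × V × ℝ) k).2.1‖ := by
      have h2 := norm_sub_le_norm_sub_add_norm_sub (g t) (denseSeq (ℝ × V × ℝ) k).2.1
        (leftLim g t)
      linarith
    have hafter : ∀ s, t < s → HasExited g k s := by
      intro s hs
      have hev := ((hg.right t).sub_const (denseSeq (ℝ × V × ℝ) k).2.1).norm.eventually
        (lt_mem_nhds hlt)
      obtain ⟨b, hb, hb'⟩ := (mem_nhdsGT_iff_exists_Ioo_subset).1 hev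
      obtain ⟨q, hq1, hq2⟩ := exists_rat_btwn (lt_min (show t < b from hb) hs)
      exact ⟨q, (hk2.trans hq1).le, (hq2.trans_le (min_le_right _ _)).le,
        hb' ⟨hq1, hq2.trans_le (min_le_left _ _)⟩⟩
    have h1 : ∀ s < t, exitClock g s + (1 / 2 : ℝ) ^ k ≤ rightLim (exitClock g) t := fun s hs =>
      ge_of_tendsto (hm.tendsto_rightLim t) (eventually_mem_nhdsWithin.mono fun x hx => by
        have := exitClock_jump g (hs.trans hx).le (hbefore s hs) (hafter x hx)
        linarith)
    have h2 : leftLim (exitClock g) t + (1 / 2 : ℝ) ^ k ≤ rightLim (exitClock g) t :=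
      le_of_tendsto ((hm.tendsto_leftLim t).add_const _)
        (eventually_mem_nhdsWithin.mono fun s hs => h1 s hs)
    have : (0 : ℝ) < (1 / 2) ^ k := by positivity
    linarith

end HittingClock

section Measurability

open Filter Set Topology Function TopologicalSpace

variable {Ω : Type*} [MeasurableSpace Ω]

/-- The left limit of a process at a measurable random time is measurable. -/
lemma measurable_of_tendsto_left {E : Type*} [TopologicalSpace E] [PseudoMetrizableSpace E]
    [MeasurableSpace E] [BorelSpace E] {G : Ω → ℝ → E} (hG : ∀ t, Measurable fun ω => G ω t)
    {τ : Ω → ℝ} (hτ : Measurable τ) {l : Ω → E}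
    (hl : ∀ ω, Tendsto (G ω) (𝓝[<] τ ω) (𝓝 (l ω))) : Measurable l := by
  refine measurable_of_tendsto_metrizable
    (f := fun (n : ℕ) ω => G ω ((⌈τ ω * (n + 1)⌉ - 1 : ℝ) / (n + 1))) (fun n => ?_) ?_
  · have h1 : Measurable fun p : Ω × ℤ => G p.1 ((p.2 - 1 : ℝ) / (n + 1)) :=
      measurable_from_prod_countable_left fun k => hG ((k - 1 : ℝ) / (n + 1))
    exact h1.comp (measurable_id.prodMk (hτ.mul_const _).ceil)
  · rw [tendsto_pi_nhds]
    intro ω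
    refine (hl ω).comp (tendsto_nhdsWithin_iff.2 ⟨?_, Eventually.of_forall fun n => ?_⟩)
    · have h0 : Tendsto (fun n : ℕ => τ ω - 1 / ((n : ℝ) + 1)) atTop (𝓝 (τ ω)) := by
        simpa using tendsto_one_div_add_atTop_nhds_zero_nat.const_sub (τ ω)
      refine tendsto_of_tendsto_of_tendsto_of_le_of_le h0 tendsto_const_nhds (fun n => ?_)
        (fun n => ?_)
      · have := Int.le_ceil (τ ω * (n + 1))
        have hn : (0 : ℝ) < n + 1 := by positivity
        simp only
        rw [le_div_iff₀ hn, sub_mul, one_div, inv_mul_cancel₀ hn.ne']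
        linarith
      · have := Int.ceil_lt_add_one (τ ω * (n + 1))
        have hn : (0 : ℝ) < n + 1 := by positivity
        simp only
        rw [div_le_iff₀ hn]
        linarith
    · have := Int.ceil_lt_add_one (τ ω * (n + 1))
      have hn : (0 : ℝ) < n + 1 := by positivity
      simp only [mem_Iio]
      rw [div_lt_iff₀ hn]
      linarith

/-- The right limit of a process at a measurable random time is measurable. -/
lemma measurable_of_tendsto_right {E : Type*} [TopologicalSpace E] [PseudoMetrizableSpace E]
    [MeasurableSpace E] [BorelSpace E] {G : Ω → ℝ → E} (hG : ∀ t, Measurable fun ω => G ω t)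
    {τ : Ω → ℝ} (hτ : Measurable τ) {l : Ω → E}
    (hl : ∀ ω, Tendsto (G ω) (𝓝[>] τ ω) (𝓝 (l ω))) : Measurable l := by
  refine measurable_of_tendsto_left (G := fun ω t => G ω (-t)) (fun t => hG (-t)) hτ.neg
    fun ω => (hl ω).comp ?_
  simpa using tendsto_neg_nhdsLT (a := -τ ω)

variable {V : Type*} [NormedAddCommGroup V]

lemma measurable_clockInv {G : Ω → ℝ → V} {σ : Ω → ℝ → ℝ} (hσ : ∀ ω, IsClock (σ ω) (G ω))
    (hσm : ∀ t, Measurable fun ω => σ ω t) {x : Ω → ℝ} (hx : Measurable x) :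
    Measurable fun ω => clockInv (σ ω) (x ω) := by
  refine measurable_of_Ici fun t => ?_
  have : (fun ω => clockInv (σ ω) (x ω)) ⁻¹' Ici t =
      ⋂ q : ℚ, {ω | (q : ℝ) < t → σ ω q ≤ x ω} := by
    ext ω
    simp only [mem_preimage, mem_Ici, mem_iInter, mem_ofPred_eq]
    refine ⟨fun h q hq => (hσ ω).le_of_lt_inv (hq.trans_le h), fun h => ?_⟩
    by_contra! hlt
    obtain ⟨q, hq1, hq2⟩ := exists_rat_btwn hlt
    exact absurd (h q hq2) (not_le.2 ((hσ ω).lt_of_inv_lt hq1))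
  rw [this]
  refine MeasurableSet.iInter fun q => ?_
  by_cases hq : (q : ℝ) < t
  · simpa [hq] using measurableSet_le (hσm q) hx
  · simp [hq]

lemma measurable_clockScale {G : Ω → ℝ → V} {σ : Ω → ℝ → ℝ} (hσ : ∀ ω, IsClock (σ ω) (G ω))
    (hσm : ∀ t, Measurable fun ω => σ ω t) (T s : ℝ) :
    Measurable fun ω => clockScale (σ ω) T s := by
  have h3 := measurable_of_tendsto_left hσm (measurable_const (a := (0 : ℝ)))
    fun ω => (hσ ω).strictMono.monotone.tendsto_leftLim _
  have h4 := measurable_of_tendsto_right hσm (measurable_const (a := T))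
    fun ω => (hσ ω).strictMono.monotone.tendsto_rightLim _
  exact h3.add (measurable_const.mul (h4.sub h3))

variable [SeparableSpace V] [MeasurableSpace V] [BorelSpace V]

open Classical in
lemma measurable_exitClock {G : Ω → ℝ → V} (hG : ∀ t, Measurable fun ω => G ω t) (t : ℝ) :
    Measurable fun ω => exitClock (G ω) t := by
  refine Measurable.const_add ?_ t
  refine measurable_of_tendsto_metrizable (fun n => ?_)
    (tendsto_pi_nhds.2 fun ω => (summable_exitClock (G ω) t).hasSum.tendsto_sum_nat)
  refine Finset.measurable_fun_sum _ fun k _ => Measurable.ite ?_ measurable_const measurable_const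
  simp only [HasExited]
  simp_rw [ofPred_exists]
  refine MeasurableSet.iUnion fun q => ?_
  refine (MeasurableSet.const _).inter ((MeasurableSet.const _).inter ?_)
  exact measurableSet_lt measurable_const (continuous_norm.measurable.comp
    ((continuous_id.sub continuous_const).measurable.comp (hG q)))

lemma measurable_filledPath [NormedSpace ℝ V] {G : Ω → ℝ → V} (hG : ∀ ω, IsCadlag (G ω))
    (hGm : ∀ t, Measurable fun ω => G ω t) {σ : Ω → ℝ → ℝ} (hσ : ∀ ω, IsClock (σ ω) (G ω))
    (hσm : ∀ t, Measurable fun ω => σ ω t) {x : Ω → ℝ} (hx : Measurable x) :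
    Measurable fun ω => filledPath (σ ω) (G ω) (x ω) := by
  have := UniformSpace.secondCountable_of_separable V
  have hr := measurable_clockInv hσ hσm hx
  have h1 := measurable_of_tendsto_left hGm hr fun ω => (hG ω).left _
  have h2 := measurable_of_tendsto_right hGm hr fun ω => (hG ω).right _
  have h3 := measurable_of_tendsto_left hσm hr fun ω => (hσ ω).strictMono.monotone.tendsto_leftLim _
  have h4 := measurable_of_tendsto_right hσm hr
    fun ω => (hσ ω).strictMono.monotone.tendsto_rightLim _
  exact h1.add (((hx.sub h3).div (h4.sub h3)).smul (h2.sub h1))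

/-- Parametric representations can be chosen measurably. -/
lemma exists_measurable_isParamRep [NormedSpace ℝ V] {T : ℝ} (hT : 0 < T) {F : Ω → ℝ → V}
    (hF : ∀ ω, IsCadlagOn (F ω) 0 T) (hFm : ∀ t ∈ Icc 0 T, Measurable fun ω => F ω t) :
    ∃ (r : Ω → ℝ → ℝ) (u : Ω → ℝ → V), (∀ ω, IsParamRep (F ω) 0 T (r ω) (u ω)) ∧
      (∀ s, Measurable fun ω => r ω s) ∧ ∀ s, Measurable fun ω => u ω s := by
  have hG := fun ω => isCadlag_clampExt hT (hF ω)
  have hσ := fun ω => isClock_exitClock (hG ω)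
  have hGm : ∀ t, Measurable fun ω => clampExt T (F ω) t := fun t =>
    hFm _ ⟨le_max_left _ _, max_le hT.le (min_le_right _ _)⟩
  have hσm := measurable_exitClock hGm
  have hx := measurable_clockScale hσ hσm T
  exact ⟨_, _, fun ω => (hσ ω).isParamRep hT (hF ω), fun s => measurable_clockInv hσ hσm (hx s),
    fun s => measurable_filledPath hG hGm hσ hσm (hx s)⟩

/-- Pointwise measurable families of continuous maps on a compact space pull back open sets to
measurable sets. -/
lemma measurableSet_preimage_continuousMap {X Y : Type*} [MetricSpace X] [CompactSpace X]
    [MetricSpace Y] [SecondCountableTopology Y] [MeasurableSpace Y] [BorelSpace Y]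
    {Φ : Ω → C(X, Y)} (hΦ : ∀ x, Measurable fun ω => Φ ω x) {U : Set C(X, Y)} (hU : IsOpen U) :
    MeasurableSet (Φ ⁻¹' U) := by
  have hdist : ∀ g : C(X, Y), Measurable fun ω => dist (Φ ω) g := fun g => by
    refine measurable_of_Iic fun c => ?_
    rcases lt_or_ge c 0 with hc | hc
    · convert MeasurableSet.empty
      ext ω
      simpa using hc.trans_le dist_nonneg
    obtain ⟨S, hS, hSd⟩ := exists_countable_dense X
    have : (fun ω => dist (Φ ω) g) ⁻¹' Iic c = ⋂ x ∈ S, {ω | dist (Φ ω x) (g x) ≤ c} := by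
      ext ω
      simp only [mem_preimage, mem_Iic, mem_iInter, mem_ofPred_eq, ContinuousMap.dist_le hc]
      refine ⟨fun h x _ => h x, fun h x => ?_⟩
      exact closure_minimal h
        (isClosed_le ((Φ ω).continuous.dist g.continuous) continuous_const) (hSd x)
    rw [this]
    exact MeasurableSet.biInter hS fun x _ =>
      measurableSet_le ((hΦ x).dist measurable_const) measurable_const
  choose! ε hε hεU using Metric.isOpen_iff.1 hU
  obtain ⟨S, hS, hSU⟩ := isOpen_biUnion_countable U (fun g => Metric.ball g (ε g))
    fun _ _ => Metric.isOpen_ball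
  have hUS : U = ⋃ g ∈ S, Metric.ball g (ε g) := by
    rw [hSU.2]
    refine Subset.antisymm (fun g hg => ?_) (iUnion₂_subset hεU)
    exact mem_iUnion₂.2 ⟨g, hg, Metric.mem_ball_self (hε g hg)⟩
  rw [hUS, preimage_iUnion₂]
  exact MeasurableSet.biUnion hSU.1 fun g _ => measurableSet_lt (hdist g) measurable_const

end Measurability

section SkorokhodMetric

open Filter Set Topology Function TopologicalSpace MeasureTheory

variable {V : Type*} [NormedAddCommGroup V] [NormedSpace ℝ V]

lemma dM_le_s11 {a b d : ℝ} {f₁ f₂ : ℝ → V} {r₁ r₂ : ℝ → ℝ} {u₁ u₂ : ℝ → V}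
    (h₁ : IsParamRep f₁ a b r₁ u₁) (h₂ : IsParamRep f₂ a b r₂ u₂)
    (hd : ∀ s ∈ Icc (0 : ℝ) 1, dist (r₁ s, u₁ s) (r₂ s, u₂ s) ≤ d) : dM a b f₁ f₂ ≤ d := by
  have hd' : ∀ s : Icc (0 : ℝ) 1, |r₁ s.1 - r₂ s.1| ≤ d ∧ ‖u₁ s.1 - u₂ s.1‖ ≤ d := fun s => by
    have := hd s.1 s.2
    rwa [Prod.dist_eq, max_le_iff, Real.dist_eq, dist_eq_norm] at this
  rw [dM]
  refine le_trans (csInf_le ⟨0, ?_⟩ (mem_ofPred.2 ⟨r₁, u₁, r₂, u₂, h₁, h₂, rfl⟩))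
    (max_le (ciSup_le fun s => (hd' s).1) (ciSup_le fun s => (hd' s).2))
  rintro _ ⟨_, _, _, _, _, _, rfl⟩
  exact le_max_of_le_left (Real.iSup_nonneg fun _ => abs_nonneg _)

lemma IsParamRep.extGraph_eq {a b : ℝ} {f : ℝ → V} {r : ℝ → ℝ} {u : ℝ → V}
    (h : IsParamRep f a b r u) : extGraph f a b = (fun s => (r s, u s)) '' Icc 0 1 :=
  Subset.antisymm h.surj (image_subset_iff.2 h.mem)

lemma exists_isParamRep [SeparableSpace V] {T : ℝ} (hT : 0 < T) {f : ℝ → V}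
    (hf : IsCadlagOn f 0 T) : ∃ r u, IsParamRep f 0 T r u :=
  ⟨_, _, (isClock_exitClock (isCadlag_clampExt hT hf)).isParamRep hT hf⟩

lemma exists_isParamRep_of_dM_lt [SeparableSpace V] {T : ℝ} (hT : 0 < T) {f₁ f₂ : ℝ → V}
    (hf₁ : IsCadlagOn f₁ 0 T) (hf₂ : IsCadlagOn f₂ 0 T) {ε : ℝ} (hε : dM 0 T f₁ f₂ < ε) :
    ∃ r₁ u₁ r₂ u₂, IsParamRep f₁ 0 T r₁ u₁ ∧ IsParamRep f₂ 0 T r₂ u₂ ∧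
      ∀ s ∈ Icc (0 : ℝ) 1, dist (r₁ s, u₁ s) (r₂ s, u₂ s) < ε := by
  obtain ⟨r, u, h⟩ := exists_isParamRep hT hf₁
  obtain ⟨r', u', h'⟩ := exists_isParamRep hT hf₂
  rw [dM] at hε
  obtain ⟨_, ⟨r₁, u₁, r₂, u₂, h₁, h₂, rfl⟩, hlt⟩ := exists_lt_of_csInf_lt
    (Set.nonempty_of_mem (mem_ofPred.2 ⟨r, u, r', u', h, h', rfl⟩)) hε
  refine ⟨r₁, u₁, r₂, u₂, h₁, h₂, fun s hs => ?_⟩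
  have c₁ := continuousOn_iff_continuous_domRestrict.1 h₁.contOn
  have c₂ := continuousOn_iff_continuous_domRestrict.1 h₂.contOn
  have b₁ : BddAbove (range fun s : Icc (0 : ℝ) 1 => |r₁ s.1 - r₂ s.1|) :=
    (isCompact_range (c₁.fst.sub c₂.fst).abs).bddAbove
  have b₂ : BddAbove (range fun s : Icc (0 : ℝ) 1 => ‖u₁ s.1 - u₂ s.1‖) :=
    (isCompact_range (c₁.snd.sub c₂.snd).norm).bddAbove
  rw [Prod.dist_eq, Real.dist_eq, dist_eq_norm]
  exact (max_le_max (le_ciSup b₁ ⟨s, hs⟩) (le_ciSup b₂ ⟨s, hs⟩)).trans_lt hlt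

/-- The σ-algebra generated by the open sets of the strong `M₁` metric. -/
abbrev borelDM (V : Type*) [NormedAddCommGroup V] [NormedSpace ℝ V] (T : ℝ) :
    MeasurableSpace {f : ℝ → V // IsCadlagOn f 0 T} :=
  MeasurableSpace.generateFrom
    {A : Set {f : ℝ → V // IsCadlagOn f 0 T} |
      ∀ f ∈ A, ∃ ε > (0:ℝ), {g : {f : ℝ → V // IsCadlagOn f 0 T} | dM 0 T g.1 f.1 < ε} ⊆ A}

/-- Avoiding a closed set is an open condition on the extended graph. -/
lemma measurableSet_disjoint_extGraph [SeparableSpace V] {T : ℝ} (hT : 0 < T) {K : Set (ℝ × V)}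
    (hK : IsClosed K) : MeasurableSet[borelDM V T]
      {f : {f : ℝ → V // IsCadlagOn f 0 T} | Disjoint (extGraph f.1 0 T) K} := by
  refine MeasurableSpace.measurableSet_generateFrom fun f hf => ?_
  obtain ⟨r, u, h⟩ := exists_isParamRep hT f.2
  have hcomp : IsCompact (extGraph f.1 0 T) :=
    h.extGraph_eq ▸ isCompact_Icc.image_of_continuousOn h.contOn
  obtain ⟨δ, hδ, hdisj⟩ := Disjoint.exists_thickenings hf hcomp hK
  refine ⟨δ, hδ, fun g hg => disjoint_left.2 fun p hp hpK => ?_⟩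
  obtain ⟨r₁, u₁, r₂, u₂, h₁, h₂, hd⟩ := exists_isParamRep_of_dM_lt hT g.2 f.2 hg
  obtain ⟨s, hs, rfl⟩ := h₁.surj p hp
  exact disjoint_left.1 hdisj (Metric.mem_thickening_iff.2 ⟨_, h₂.mem s hs, hd s hs⟩)
    (Metric.self_subset_thickening hδ _ hpK)

lemma mem_extGraph_self {a b : ℝ} (f : ℝ → V) {t : ℝ} (ht : t ∈ Icc a b) :
    (t, f t) ∈ extGraph f a b :=
  ⟨ht, 0, ⟨le_rfl, zero_le_one⟩, by simp⟩

/-- Before the terminal time, membership of `f t` in an open set is detected by the extended graph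
immediately after `t`. -/
lemma mem_open_iff_disjoint_extGraph {T : ℝ} (hT : 0 < T) {f : ℝ → V} (hf : IsCadlagOn f 0 T)
    {t : ℝ} (ht : t ∈ Ico 0 T) {U : Set V} (hU : IsOpen U) :
    f t ∈ U ↔ ∃ m n : ℕ, ∀ k : ℕ, Disjoint (extGraph f 0 T)
      (Icc (t + 1 / (k + 1)) (t + 1 / (n + 1)) ×ˢ Metric.cthickening (1 / ((m : ℝ) + 1)) Uᶜ) := by
  have hg := isCadlag_clampExt hT hf
  have hgt := clampExt_of_mem f (Ico_subset_Icc_self ht)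
  have hright := hg.right t
  rw [hgt] at hright
  constructor
  · intro hfU
    obtain ⟨ε, hε, hball⟩ := Metric.isOpen_iff.1 hU _ hfU
    obtain ⟨b, hb, hb'⟩ := mem_nhdsGT_iff_exists_Ioo_subset.1
      (hright.eventually (Metric.closedBall_mem_nhds _ (half_pos hε)))
    obtain ⟨n, hn⟩ := exists_nat_one_div_lt (sub_pos.2 (show t < b from hb))
    obtain ⟨m, hm⟩ := exists_nat_one_div_lt (half_pos (half_pos hε))
    refine ⟨m, n, fun k => disjoint_left.2 ?_⟩
    rintro ⟨s, v⟩ ⟨hs, α, hα, hv⟩ ⟨⟨hs1, hs2⟩, hvU⟩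
    simp only at hs hv hs1 hs2 hvU
    have hk : (0 : ℝ) < 1 / (k + 1) := by positivity
    have hsb : s ∈ Ioo t b := ⟨by linarith, by linarith⟩
    have hvb : v ∈ Metric.closedBall (f t) (ε / 2) := by
      rw [hv, leftLimIn_eq_leftLim_clampExt hT hf hs, ← clampExt_of_mem f hs]
      exact convex_closedBall _ _ (hg.leftLim_mem Metric.isClosed_closedBall
        (fun x hx => hb' hx) hsb) (hb' hsb) hα.1 (sub_nonneg.2 hα.2) (by ring)
    have hvU' := Metric.cthickening_subset_thickening' (half_pos hε)
      (hm.trans (half_lt_self (half_pos hε))) _ hvU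
    obtain ⟨w, hw, hwd⟩ := Metric.mem_thickening_iff.1 hvU'
    refine hw (hball ?_)
    rw [Metric.mem_ball]
    have := dist_triangle_left w (f t) v
    rw [Metric.mem_closedBall] at hvb
    linarith
  · rintro ⟨m, n, hmn⟩
    by_contra hfU
    have hm : (0 : ℝ) < 1 / ((m : ℝ) + 1) := by positivity
    have hn : (0 : ℝ) < 1 / ((n : ℝ) + 1) := by positivity
    obtain ⟨b, hb, hb'⟩ := mem_nhdsGT_iff_exists_Ioo_subset.1
      (hright.eventually (Metric.ball_mem_nhds _ hm))
    obtain ⟨s, hts, hs⟩ := exists_between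
      (lt_min (lt_min (show t < b from hb) ht.2) (lt_add_of_pos_right t hn))
    rw [lt_min_iff, lt_min_iff] at hs
    obtain ⟨k, hk⟩ := exists_nat_one_div_lt (sub_pos.2 hts)
    have hsT : s ∈ Icc 0 T := ⟨ht.1.trans hts.le, hs.1.2.le⟩
    have hsd : dist (clampExt T f s) (f t) < 1 / ((m : ℝ) + 1) := hb' ⟨hts, hs.1.1⟩
    rw [clampExt_of_mem f hsT] at hsd
    exact disjoint_left.1 (hmn k) (mem_extGraph_self f hsT)
      ⟨⟨by linarith, hs.2.le⟩, Metric.mem_cthickening_of_dist_le _ _ _ _ hfU hsd.le⟩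

/-- Evaluations are Borel measurable for the strong `M₁` metric. -/
lemma measurable_eval_borelDM [SeparableSpace V] [MeasurableSpace V] [BorelSpace V] {T : ℝ}
    (hT : 0 < T) {t : ℝ} (ht : t ∈ Icc 0 T) :
    Measurable[borelDM V T] fun f : {f : ℝ → V // IsCadlagOn f 0 T} => f.1 t := by
  let _ := borelDM V T
  refine measurable_of_isOpen fun U hU => ?_
  rcases ht.2.lt_or_eq with hlt | rfl
  · have : (fun f : {f : ℝ → V // IsCadlagOn f 0 T} => f.1 t) ⁻¹' U =
        ⋃ (m : ℕ) (n : ℕ), ⋂ k : ℕ, {f | Disjoint (extGraph f.1 0 T)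
          (Icc (t + 1 / (k + 1)) (t + 1 / (n + 1)) ×ˢ
            Metric.cthickening (1 / ((m : ℝ) + 1)) Uᶜ)} := by
      ext f
      simp only [mem_preimage, mem_iUnion, mem_iInter, mem_ofPred_eq]
      exact mem_open_iff_disjoint_extGraph hT f.2 ⟨ht.1, hlt⟩ hU
    rw [this]
    exact MeasurableSet.iUnion fun m => MeasurableSet.iUnion fun n => MeasurableSet.iInter fun k =>
      measurableSet_disjoint_extGraph hT (isClosed_Icc.prod Metric.isClosed_cthickening)
  · refine MeasurableSpace.measurableSet_generateFrom fun f hf => ?_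
    obtain ⟨ε, hε, hball⟩ := Metric.isOpen_iff.1 hU _ hf
    refine ⟨ε, hε, fun g hg => hball ?_⟩
    obtain ⟨r₁, u₁, r₂, u₂, h₁, h₂, hd⟩ := exists_isParamRep_of_dM_lt hT g.2 f.2 hg
    have := hd 1 ⟨zero_le_one, le_rfl⟩
    rw [h₁.last.1, h₁.last.2, h₂.last.1, h₂.last.2, Prod.dist_eq] at this
    exact (le_max_right _ _).trans_lt this

/-- A σ-algebra on the càdlàg functions that makes all evaluations measurable contains the open
sets of the strong `M₁` metric. -/
lemma borelDM_le [SeparableSpace V] [MeasurableSpace V] [BorelSpace V] {T : ℝ} (hT : 0 < T)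
    {mD : MeasurableSpace {f : ℝ → V // IsCadlagOn f 0 T}}
    (hm : ∀ t ∈ Icc 0 T, Measurable fun f : {f : ℝ → V // IsCadlagOn f 0 T} => f.1 t) :
    borelDM V T ≤ mD := by
  have := UniformSpace.secondCountable_of_separable V
  obtain ⟨r, u, hrep, hr, hu⟩ :=
    exists_measurable_isParamRep hT (fun f : {f : ℝ → V // IsCadlagOn f 0 T} => f.2) hm
  let Φ : {f : ℝ → V // IsCadlagOn f 0 T} → C(Icc (0 : ℝ) 1, ℝ × V) := fun f =>
    ⟨_, continuousOn_iff_continuous_domRestrict.1 (hrep f).contOn⟩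
  have hΦ : ∀ s, Measurable fun f => Φ f s := fun s => (hr s).prodMk (hu s)
  refine MeasurableSpace.generateFrom_le fun A hA => ?_
  choose! ε hε hεA using hA
  have hpre : A = Φ ⁻¹' ⋃ f ∈ A, Metric.ball (Φ f) (ε f) := by
    refine Subset.antisymm (fun f hf => mem_iUnion₂.2 ⟨f, hf, Metric.mem_ball_self (hε f hf)⟩) ?_
    intro g hg
    obtain ⟨f, hf, hgf⟩ := mem_iUnion₂.1 hg
    refine hεA f hf ((dM_le_s11 (hrep g) (hrep f) fun s hs => ?_).trans_lt hgf)
    exact ContinuousMap.dist_apply_le_dist (f := Φ g) (g := Φ f) ⟨s, hs⟩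
  rw [hpre]
  exact measurableSet_preimage_continuousMap hΦ
    (isOpen_biUnion fun f _ => Metric.isOpen_ball)

end SkorokhodMetric

/-- for a separable real Banach space `V`, the Borel σ-algebra of
`(D([0,T];V), d_M)` (generated by the `d_M`-open sets) coincides with the σ-algebra
generated by the coordinate mappings `f ↦ (f(t₁), …, f(tₙ))`. -/
theorem borel_dM_eq_cylindrical {V : Type*} [NormedAddCommGroup V] [NormedSpace ℝ V]
    [CompleteSpace V] [TopologicalSpace.SeparableSpace V]
    [MeasurableSpace V] [BorelSpace V]
    (T : ℝ) (hT : 0 < T) :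
    MeasurableSpace.generateFrom
        {A : Set {f : ℝ → V // IsCadlagOn f 0 T} |
          ∀ f ∈ A, ∃ ε > (0:ℝ),
            {g : {f : ℝ → V // IsCadlagOn f 0 T} | dM 0 T g.1 f.1 < ε} ⊆ A} =
      MeasurableSpace.generateFrom
        {A : Set {f : ℝ → V // IsCadlagOn f 0 T} |
          ∃ (n : ℕ) (ts : Fin n → ℝ), (∀ i, ts i ∈ Set.Icc (0:ℝ) T) ∧
            ∃ B : Set (Fin n → V), MeasurableSet B ∧
              A = {g | (fun i => g.1 (ts i)) ∈ B}} := by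
  refine le_antisymm (borelDM_le hT fun t ht B hB => ?_) (MeasurableSpace.generateFrom_le ?_)
  · exact MeasurableSpace.measurableSet_generateFrom
      ⟨1, fun _ => t, fun _ => ht, (fun v => v 0) ⁻¹' B, measurable_pi_apply 0 hB, rfl⟩
  · rintro A ⟨n, ts, hts, B, hB, rfl⟩
    let _ := borelDM V T
    exact (measurable_pi_iff.2 fun i => measurable_eval_borelDM hT (hts i)) hB
end

section
/- Let V be a separable real Banach space and let X = (X(t) : t ∈ [0,T]) be a V-valued stochastically continuous stochastic process with càdlàg trajectories. Then for every ε > 0, lim_{δ ↘ 0} sup_{t ∈ [0,T]} P( sup{ ‖X(t) − X(s)‖ : s ∈ [0,T], |s − t| ≤ δ } ≥ ε ) = 0. -/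
open Filter Set Topology

/-- The set of outcomes for which a path moves by more than `c` from its value at `t`, within
distance `r` of `t`, is measurable: by right-continuity it is seen along a countable set of
times. -/
theorem measurableSet_exists_lt_norm_sub {V : Type*} [NormedAddCommGroup V]
    [TopologicalSpace.SeparableSpace V] [MeasurableSpace V] [BorelSpace V]
    {Ω : Type*} [MeasurableSpace Ω] {T : ℝ} {X : ℝ → Ω → V}
    (hmeas : ∀ t ∈ Set.Icc (0:ℝ) T, Measurable (X t))
    (hcad : ∀ ω, IsCadlagOn (fun t => X t ω) 0 T)
    {t : ℝ} (ht : t ∈ Set.Icc (0:ℝ) T) (r c : ℝ) :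
    MeasurableSet {ω | ∃ s ∈ Set.Icc (0:ℝ) T, |s - t| < r ∧ c < ‖X s ω - X t ω‖} := by
  have : SecondCountableTopology V := UniformSpace.secondCountable_of_separable V
  have hcount : ((Set.range ((↑) : ℚ → ℝ) ∪ {T}) ∩
      {s | s ∈ Set.Icc (0:ℝ) T ∧ |s - t| < r}).Countable :=
    ((Set.countable_range _).union (Set.countable_singleton T)).mono Set.inter_subset_left
  have heq : {ω | ∃ s ∈ Set.Icc (0:ℝ) T, |s - t| < r ∧ c < ‖X s ω - X t ω‖} =
      ⋃ s ∈ (Set.range ((↑) : ℚ → ℝ) ∪ {T}) ∩ {s | s ∈ Set.Icc (0:ℝ) T ∧ |s - t| < r},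
        {ω | c < ‖X s ω - X t ω‖} := by
    ext ω
    simp only [Set.mem_iUnion, Set.mem_ofPred_eq, exists_prop]
    constructor
    · rintro ⟨s, hs, hsr, hsc⟩
      rcases hs.2.eq_or_lt with rfl | hsT
      · exact ⟨s, ⟨Or.inr rfl, hs, hsr⟩, hsc⟩
      have hright := (hcad ω).1 s ⟨hs.1, hsT⟩
      rw [nhdsWithin_Ioc_eq_nhdsGT hsT] at hright
      have hfar : ∀ᶠ u in 𝓝[>] s, c < ‖X u ω - X t ω‖ :=
        (hright.sub_const (X t ω)).norm.eventually (lt_mem_nhds hsc)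
      have hnear : ∀ᶠ u in 𝓝[>] s, |u - t| < r :=
        nhdsWithin_le_nhds <| (by fun_prop : Continuous fun u : ℝ => |u - t|).continuousAt.eventually
          (gt_mem_nhds hsr)
      have hle : ∀ᶠ u in 𝓝[>] s, u < T := nhdsWithin_le_nhds (gt_mem_nhds hsT)
      obtain ⟨u, hu, hsub⟩ := mem_nhdsGT_iff_exists_Ioo_subset.1 (hfar.and (hnear.and hle))
      obtain ⟨q, hq⟩ := exists_rat_btwn (show s < u from hu)
      obtain ⟨h1, h2, h3⟩ := hsub hq
      exact ⟨q, ⟨Or.inl ⟨q, rfl⟩, ⟨hs.1.trans hq.1.le, h3.le⟩, h2⟩, h1⟩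
    · rintro ⟨s, ⟨-, hs, hsr⟩, hsc⟩
      exact ⟨s, hs, hsr, hsc⟩
  rw [heq]
  exact MeasurableSet.biUnion hcount fun s hs =>
    measurableSet_lt measurable_const ((hmeas s hs.2.1).sub (hmeas t ht)).norm

open MeasureTheory in
/-- A stochastically continuous càdlàg process almost surely has no jump at a fixed time. -/
theorem measure_forall_exists_lt_norm_sub_eq_zero {V : Type*} [NormedAddCommGroup V]
    {Ω : Type*} [MeasurableSpace Ω] {P : Measure Ω} {T : ℝ} {X : ℝ → Ω → V}
    (hcad : ∀ ω, IsCadlagOn (fun t => X t ω) 0 T)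
    {t : ℝ} (ht : t ∈ Set.Icc (0:ℝ) T)
    (hsc : ∀ ε > (0:ℝ), Filter.Tendsto (fun s => P {ω | ε ≤ ‖X s ω - X t ω‖})
        (nhdsWithin t (Set.Icc 0 T)) (nhds 0))
    {c : ℝ} (hc : 0 < c) :
    P {ω | ∀ r > (0:ℝ), ∃ s ∈ Set.Icc (0:ℝ) T, |s - t| < r ∧ c < ‖X s ω - X t ω‖} = 0 := by
  have hjump : ∀ ω ∈ {ω | ∀ r > (0:ℝ), ∃ s ∈ Set.Icc (0:ℝ) T,
      |s - t| < r ∧ c < ‖X s ω - X t ω‖},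
      0 < t ∧ ∀ᶠ s in 𝓝[Ico 0 t] t, c / 2 ≤ ‖X s ω - X t ω‖ := by
    intro ω hω
    have hfreq : ∃ᶠ s in 𝓝[Icc 0 T] t, c < ‖X s ω - X t ω‖ := by
      intro hev
      obtain ⟨r, hr, hsub⟩ := Metric.mem_nhdsWithin_iff.1 hev
      obtain ⟨s, hs, hsr, hlt⟩ := hω r hr
      exact hsub ⟨by simpa [Real.dist_eq] using hsr, hs⟩ hlt
    have hcover : Icc 0 T ⊆ Ico 0 t ∪ ({t} ∪ Ioc t T) := by
      intro s hs
      rcases lt_trichotomy s t with h | h | h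
      · exact Or.inl ⟨hs.1, h⟩
      · exact Or.inr (Or.inl h)
      · exact Or.inr (Or.inr ⟨h, hs.2⟩)
    have hright : ∀ᶠ s in 𝓝[{t} ∪ Ioc t T] t, ¬ c < ‖X s ω - X t ω‖ := by
      rw [nhdsWithin_union, eventually_sup]
      refine ⟨by simp [nhdsWithin_singleton, hc.le], ?_⟩
      rcases ht.2.eq_or_lt with rfl | htT
      · simp
      have h := (((hcad ω).1 t ⟨ht.1, htT⟩).sub_const (X t ω)).norm
      simp only [sub_self, norm_zero] at h
      exact (h.eventually (gt_mem_nhds hc)).mono fun s hs => hs.not_gt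
    have hleft : ∃ᶠ s in 𝓝[Ico 0 t] t, c < ‖X s ω - X t ω‖ := by
      have h := hfreq.filter_mono (nhdsWithin_mono t hcover)
      rw [nhdsWithin_union, frequently_sup] at h
      exact h.resolve_right (not_frequently.2 hright)
    have ht0 : 0 < t := by
      refine ht.1.lt_of_ne fun h => ?_
      subst h
      simp at hleft
    obtain ⟨l, hl⟩ := (hcad ω).2 t ⟨ht0, ht.2⟩
    have hnorm := (hl.sub_const (X t ω)).norm
    have hcl : c ≤ ‖l - X t ω‖ := by
      by_contra! hlt
      exact hleft ((hnorm.eventually (gt_mem_nhds hlt)).mono fun s hs => hs.not_gt)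
    exact ⟨ht0, (hnorm.eventually (lt_mem_nhds (by linarith : c / 2 < ‖l - X t ω‖))).mono
      fun s hs => hs.le⟩
  rcases ht.1.eq_or_lt with rfl | ht0
  · exact measure_mono_null (fun ω hω => (lt_irrefl _ (hjump ω hω).1).elim) measure_empty
  have hne : (𝓝[Ico 0 t] t).NeBot := by
    rw [nhdsWithin_Ico_eq_nhdsLT ht0]
    infer_instance
  refine measure_mono_null (t := ⋃ n : ℕ, {ω | ∀ s ∈ Ico 0 t, |s - t| < 1 / ((n : ℝ) + 1) →
    c / 2 ≤ ‖X s ω - X t ω‖}) (fun ω hω => ?_) (measure_iUnion_null fun n => ?_)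
  · obtain ⟨r, hr, hsub⟩ := Metric.mem_nhdsWithin_iff.1 (hjump ω hω).2
    obtain ⟨n, hn⟩ := exists_nat_one_div_lt hr
    exact Set.mem_iUnion.2 ⟨n, fun s hs hsn =>
      hsub ⟨by simpa [Real.dist_eq] using hsn.trans hn, hs⟩⟩
  · have hlim := (hsc (c / 2) (half_pos hc)).mono_left
      (nhdsWithin_mono t (Ico_subset_Icc_self.trans (Icc_subset_Icc_right ht.2)))
    refine le_antisymm (ge_of_tendsto hlim ?_) bot_le
    have hball : ∀ᶠ s in 𝓝[Ico 0 t] t, dist s t < 1 / ((n : ℝ) + 1) :=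
      nhdsWithin_le_nhds (Metric.ball_mem_nhds t Nat.one_div_pos_of_nat)
    filter_upwards [self_mem_nhdsWithin, hball] with s hs hsn
    exact measure_mono fun ω hω => hω s hs (by simpa [Real.dist_eq] using hsn)

open MeasureTheory in
/-- Oscillation of a stochastically continuous càdlàg process around a fixed time tends to zero
in probability. -/
theorem tendsto_measure_exists_lt_norm_sub {V : Type*} [NormedAddCommGroup V]
    [TopologicalSpace.SeparableSpace V] [MeasurableSpace V] [BorelSpace V]
    {Ω : Type*} [MeasurableSpace Ω] {P : Measure Ω} [IsFiniteMeasure P]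
    {T : ℝ} {X : ℝ → Ω → V}
    (hmeas : ∀ t ∈ Set.Icc (0:ℝ) T, Measurable (X t))
    (hcad : ∀ ω, IsCadlagOn (fun t => X t ω) 0 T)
    {t : ℝ} (ht : t ∈ Set.Icc (0:ℝ) T)
    (hsc : ∀ ε > (0:ℝ), Filter.Tendsto (fun s => P {ω | ε ≤ ‖X s ω - X t ω‖})
        (nhdsWithin t (Set.Icc 0 T)) (nhds 0))
    {c : ℝ} (hc : 0 < c) :
    Tendsto (fun n : ℕ => P {ω | ∃ s ∈ Set.Icc (0:ℝ) T,
      |s - t| < 1 / ((n : ℝ) + 1) ∧ c < ‖X s ω - X t ω‖}) atTop (𝓝 0) := by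
  have h := tendsto_measure_iInter_atTop (μ := P)
    (fun n : ℕ => (measurableSet_exists_lt_norm_sub hmeas hcad ht
      (1 / ((n : ℝ) + 1)) c).nullMeasurableSet)
    (fun m n hmn ω ⟨s, hs, hsr, hlt⟩ =>
      ⟨s, hs, hsr.trans_le (Nat.one_div_le_one_div hmn), hlt⟩)
    ⟨0, measure_ne_top P _⟩
  rwa [measure_mono_null (fun ω hω r hr => ?_)
    (measure_forall_exists_lt_norm_sub_eq_zero hcad ht hsc hc)] at h
  obtain ⟨n, hn⟩ := exists_nat_one_div_lt hr
  obtain ⟨s, hs, hsr, hlt⟩ := Set.mem_iInter.1 hω n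
  exact ⟨s, hs, hsr.trans hn, hlt⟩

open MeasureTheory in
/-- a stochastically continuous `V`-valued process with càdlàg trajectories
satisfies `lim_{δ↘0} sup_{t∈[0,T]} P( sup_{|s−t|≤δ, s∈[0,T]} ‖X(t) − X(s)‖ ≥ ε ) = 0`
for every `ε > 0`. -/
theorem sup_prob_oscillation_tendsto_zero {V : Type*} [NormedAddCommGroup V]
    [NormedSpace ℝ V] [CompleteSpace V] [TopologicalSpace.SeparableSpace V]
    [MeasurableSpace V] [BorelSpace V]
    {Ω : Type*} [MeasurableSpace Ω] (P : Measure Ω) [IsProbabilityMeasure P]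
    (T : ℝ) (hT : 0 < T) (X : ℝ → Ω → V)
    (hmeas : ∀ t ∈ Set.Icc (0:ℝ) T, Measurable (X t))
    (hcad : ∀ ω, IsCadlagOn (fun t => X t ω) 0 T)
    (hsc : ∀ t ∈ Set.Icc (0:ℝ) T, ∀ ε > (0:ℝ),
      Filter.Tendsto (fun s => P {ω | ε ≤ ‖X s ω - X t ω‖})
        (nhdsWithin t (Set.Icc 0 T)) (nhds 0))
    (ε : ℝ) (hε : 0 < ε) :
    Filter.Tendsto
      (fun δ : ℝ => ⨆ t : Set.Icc (0:ℝ) T,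
        P {ω | ε ≤ sSup {d : ℝ | ∃ s ∈ Set.Icc (0:ℝ) T, |s - t.1| ≤ δ ∧
            d = ‖X t.1 ω - X s ω‖}})
      (nhdsWithin 0 (Set.Ioi 0)) (nhds 0) := by
  rw [ENNReal.tendsto_nhds_zero]
  intro η hη
  have hη2 : 0 < η / 2 := ENNReal.half_pos hη.ne'
  have hc : 0 < ε / 4 := by positivity
  suffices h : ∀ᶠ δ : ℝ in 𝓝[>] 0, ∀ t ∈ Icc (0:ℝ) T,
      P {ω | ε ≤ sSup {d : ℝ | ∃ s ∈ Set.Icc (0:ℝ) T, |s - t| ≤ δ ∧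
        d = ‖X t ω - X s ω‖}} ≤ η from
    h.mono fun δ hδ => iSup_le fun t => hδ t.1 t.2
  refine isCompact_Icc.induction_on (p := fun S => ∀ᶠ δ : ℝ in 𝓝[>] 0, ∀ t ∈ S,
      P {ω | ε ≤ sSup {d : ℝ | ∃ s ∈ Set.Icc (0:ℝ) T, |s - t| ≤ δ ∧
        d = ‖X t ω - X s ω‖}} ≤ η) (by simp)
    (fun S S' hSS' h => h.mono fun δ hδ t ht => hδ t (hSS' ht))
    (fun S S' h h' => (h.and h').mono fun δ hδ t ht => ht.elim (hδ.1 t) (hδ.2 t)) ?_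
  intro t₀ ht₀
  obtain ⟨n, hn⟩ := ((ENNReal.tendsto_nhds_zero.1 (tendsto_measure_exists_lt_norm_sub hmeas hcad
    ht₀ (hsc t₀ ht₀) hc)) (η / 2) hη2).exists
  set r : ℝ := 1 / ((n : ℝ) + 1)
  have hr0 : 0 < r := Nat.one_div_pos_of_nat
  have hball : ∀ᶠ t in 𝓝[Icc 0 T] t₀, dist t t₀ < r / 2 :=
    nhdsWithin_le_nhds (Metric.ball_mem_nhds t₀ (half_pos hr0))
  refine ⟨_, (((ENNReal.tendsto_nhds_zero.1 (hsc t₀ ht₀ (ε / 4) hc)) (η / 2) hη2).and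
    (hball.and self_mem_nhdsWithin)), ?_⟩
  filter_upwards [self_mem_nhdsWithin, nhdsWithin_le_nhds (gt_mem_nhds (half_pos hr0))]
    with δ (hδ : 0 < δ) hδr
  rintro t ⟨htη, htr, ht⟩
  rw [Real.dist_eq] at htr
  rw [← ENNReal.add_halves η]
  refine (measure_mono fun ω hω => ?_).trans ((measure_union_le _ _).trans (add_le_add htη hn))
  have hne : {d : ℝ | ∃ s ∈ Set.Icc (0:ℝ) T, |s - t| ≤ δ ∧ d = ‖X t ω - X s ω‖}.Nonempty :=
    ⟨_, t, ht, by simpa using hδ.le, rfl⟩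
  obtain ⟨_, ⟨s, hs, hst, rfl⟩, hlt⟩ := exists_lt_of_lt_csSup hne ((half_lt_self hε).trans_le hω)
  by_cases hclose : ε / 4 ≤ ‖X t ω - X t₀ ω‖
  · exact Or.inl hclose
  · refine Or.inr ⟨s, hs, ?_, ?_⟩
    · linarith [abs_sub_le s t t₀]
    · have htri := norm_sub_le_norm_sub_add_norm_sub (X t ω) (X t₀ ω) (X s ω)
      rw [norm_sub_rev (X t₀ ω)] at htri
      linarith [not_le.1 hclose]
end
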